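/- Let ℓ ∈ (1,2] and let f be a Cherry map of exponent ℓ whose rotation number ρ(f) is of bounded type, with q_n the denominators of the convergents of ρ(f), and let c be the constant value of f on the closure of U. Then there exist constants K' > 0 and C ∈ (0,1) such that for all sufficiently large n₀, Σ_{l=n₀}^∞ (−log |f^{q_{l+2}}(c) − c|)/q_{l+1} ≤ K'·C^{n₀}; in particular these tails tend to 0 as n₀ → ∞. -/

import Mathlib

open Filter

noncomputable section

/-- The Gauss map `x ↦ {1/x}`. -/
def gaussMap (x : ℝ) : ℝ := Int.fract (1 / x)

/-- The `n`-th partial quotient (`n ≥ 1`) of the continued fraction expansion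
`ρ = [0; a_1, a_2, …]` of an irrational `ρ ∈ (0,1)`. -/
def cfA (ρ : ℝ) (n : ℕ) : ℕ := ⌊1 / (gaussMap^[n - 1] ρ)⌋₊

/-- The denominators of the convergents of `ρ`: `q_0 = 1`, `q_1 = a_1`,
`q_{n+2} = a_{n+2} q_{n+1} + q_n`. -/
def cfQ (ρ : ℝ) : ℕ → ℕ
  | 0 => 1
  | 1 => cfA ρ 1
  | n + 2 => cfA ρ (n + 2) * cfQ ρ (n + 1) + cfQ ρ n

/-- `ρ` is of bounded type if its partial quotients are bounded. -/
def BoundedType (ρ : ℝ) : Prop := ∃ M : ℕ, ∀ i ≥ 1, cfA ρ i ≤ M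

/-- A Cherry map of exponent `ℓ > 1`: a continuous degree-one monotone circle map with a
flat open arc `U = (a,b)`, a `C^∞` diffeomorphism off the closure of `U`, behaving like
`x ↦ x^ℓ` in one-sided `C^∞` local coordinates at the endpoints of `U`, and with no
periodic points (hence irrational rotation number `rho`). -/
structure CherryMap (ℓ : ℝ) where
  /-- the circle map -/
  f : AddCircle (1 : ℝ) → AddCircle (1 : ℝ)
  /-- a lift of `f` to the real line -/
  F : ℝ → ℝ
  cont : Continuous f
  isLift : ∀ x : ℝ, f (x : AddCircle (1 : ℝ)) = ((F x : ℝ) : AddCircle (1 : ℝ))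
  mono : Monotone F
  degree_one : ∀ x : ℝ, F (x + 1) = F x + 1
  /-- left endpoint of the flat arc -/
  a : ℝ
  /-- right endpoint of the flat arc -/
  b : ℝ
  hab : a < b
  hba : b < a + 1
  /-- `f` is constant on the closure of `U = (a,b)` -/
  flat : ∀ x ∈ Set.Icc a b, F x = F a
  /-- `f` is `C^∞` off the closure of `U` -/
  smooth : ContDiffOn ℝ (⊤ : ℕ∞) F (Set.Ioo b (a + 1))
  /-- `f` is a diffeomorphism onto its image off the closure of `U` -/
  deriv_pos : ∀ x ∈ Set.Ioo b (a + 1), 0 < deriv F x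
  /-- radius of the one-sided coordinate neighbourhoods at `a` and `b` -/
  ε : ℝ
  εpos : 0 < ε
  /-- `C^∞` local coordinate at `a` -/
  ψa : ℝ → ℝ
  /-- `C^∞` local coordinate at `b` -/
  ψb : ℝ → ℝ
  ψa_smooth : ContDiff ℝ (⊤ : ℕ∞) ψa
  ψb_smooth : ContDiff ℝ (⊤ : ℕ∞) ψb
  ψa_zero : ψa 0 = 0
  ψb_zero : ψb 0 = 0
  ψa_deriv_pos : 0 < deriv ψa 0
  ψb_deriv_pos : 0 < deriv ψb 0
  /-- near `b`, `f` is `x ↦ x^ℓ` in the local coordinate -/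
  local_b : ∀ t ∈ Set.Ico (0 : ℝ) ε, F (b + t) = F b + ψb (t ^ ℓ)
  /-- near `a`, `f` is `x ↦ x^ℓ` in the local coordinate -/
  local_a : ∀ t ∈ Set.Ico (0 : ℝ) ε, F (a - t) = F a - ψa (t ^ ℓ)
  /-- `f` has no periodic points -/
  no_periodic_pt : ∀ (x : AddCircle (1 : ℝ)) (n : ℕ), 1 ≤ n → f^[n] x ≠ x
  /-- the rotation number of `f` -/
  rho : ℝ
  rho_mem : rho ∈ Set.Ioo (0 : ℝ) 1
  rho_irrational : Irrational rho
  rho_lim : ∃ m : ℤ, ∀ x : ℝ,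
    Tendsto (fun n : ℕ => F^[n] x / n) atTop (nhds (rho + m))

namespace CherryMap

variable {ℓ : ℝ}

/-- The flat arc `U = (a,b)` of a Cherry map, as a subset of the circle. -/
def U (X : CherryMap ℓ) : Set (AddCircle (1 : ℝ)) :=
  (fun t : ℝ => (t : AddCircle (1 : ℝ))) '' Set.Ioo X.a X.b

/-- The constant value `c = f(a)` of a Cherry map on the closure of its flat arc. -/
def c (X : CherryMap ℓ) : AddCircle (1 : ℝ) := X.f ((X.a : ℝ) : AddCircle (1 : ℝ))

end CherryMap

end

section Diophantine

theorem cfA_gaussMap (x : ℝ) {n : ℕ} (hn : 1 ≤ n) : cfA (gaussMap x) n = cfA x (n + 1) := by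
  obtain ⟨m, rfl⟩ := Nat.exists_eq_add_of_le' hn
  simp [cfA, Function.iterate_succ_apply]

theorem gaussMap_mem_Ioo {x : ℝ} (hx : Irrational x) : gaussMap x ∈ Set.Ioo (0 : ℝ) 1 := by
  refine ⟨Int.fract_pos.2 ?_, Int.fract_lt_one _⟩
  have : Irrational (1 / x) := by simpa using hx.inv
  exact this.ne_int _

theorem irrational_gaussMap {x : ℝ} (hx : Irrational x) : Irrational (gaussMap x) := by
  have : Irrational (1 / x) := by simpa using hx.inv
  exact this.sub_intCast _

theorem one_div_eq_cfA_add_gaussMap {x : ℝ} (hx : 0 < x) :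
    1 / x = cfA x 1 + gaussMap x := by
  simp only [cfA, gaussMap, Nat.sub_self, Function.iterate_zero, id]
  rw [natCast_floor_eq_intCast_floor (by positivity)]
  exact (Int.floor_add_fract _).symm

theorem one_le_cfA_one {x : ℝ} (hx : x ∈ Set.Ioo (0 : ℝ) 1) : 1 ≤ cfA x 1 := by
  simp only [cfA, Nat.sub_self, Function.iterate_zero, id]
  exact Nat.le_floor (by simpa using (one_le_inv₀ hx.1).2 hx.2.le)

theorem one_le_cfA {x : ℝ} (hx : x ∈ Set.Ioo (0 : ℝ) 1) (hirr : Irrational x) (n : ℕ) :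
    1 ≤ cfA x (n + 1) := by
  induction n generalizing x with
  | zero => exact one_le_cfA_one hx
  | succ n ih =>
    rw [← cfA_gaussMap x (by omega)]
    exact ih (gaussMap_mem_Ioo hirr) (irrational_gaussMap hirr)

theorem inv_le_of_cfA_le {x : ℝ} (hx : x ∈ Set.Ioo (0 : ℝ) 1) (hirr : Irrational x) {M : ℕ}
    (hM : cfA x 1 ≤ M) : 1 / ((M : ℝ) + 1) ≤ x := by
  have h1 := one_div_eq_cfA_add_gaussMap hx.1
  have h2 := (gaussMap_mem_Ioo hirr).2
  have h3 : (cfA x 1 : ℝ) ≤ M := by exact_mod_cast hM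
  rw [div_le_iff₀ (by positivity)]
  have : 1 / x ≤ M + 1 := by linarith
  rw [div_le_iff₀ hx.1] at this
  linarith

/-- The invariance of the indefinite form `(t x - k) (t + k y) / (1 + x y)` under the natural
extension of the Gauss map bounds it from below on integer points. -/
theorem badlyApproximable_aux {M : ℕ} (t : ℕ) : ∀ {x y : ℝ} {k : ℤ},
    x ∈ Set.Ioo (0 : ℝ) 1 → Irrational x → (∀ i ≥ 1, cfA x i ≤ M) → y ∈ Set.Icc (0 : ℝ) 1 →
    1 ≤ t → 0 ≤ k →
    1 / (2 * ((M : ℝ) + 1) ^ 2) * (1 + x * y) ≤ |t * x - k| * (t + k * y) := by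
  induction t using Nat.strong_induction_on with
  | _ t ih =>
  intro x y k hx hirr hM hy ht hk
  have hM0 : (0 : ℝ) < (M : ℝ) + 1 := by positivity
  set m : ℝ := 1 / ((M : ℝ) + 1) with hm
  have hmpos : 0 < m := by positivity
  have hm1 : m ≤ 1 := by rw [hm, div_le_one hM0]; linarith [(Nat.cast_nonneg M : (0 : ℝ) ≤ M)]
  have hxm : m ≤ x := inv_le_of_cfA_le hx hirr (hM 1 le_rfl)
  set x₁ := gaussMap x with hx₁
  have hx₁m : x₁ ∈ Set.Ioo (0 : ℝ) 1 := gaussMap_mem_Ioo hirr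
  have hirr₁ := irrational_gaussMap hirr
  have hM₁ : ∀ i ≥ 1, cfA x₁ i ≤ M := fun i hi => by
    rw [hx₁, cfA_gaussMap x hi]; exact hM _ (by omega)
  have hx₁m' : m ≤ x₁ := inv_le_of_cfA_le hx₁m hirr₁ (hM₁ 1 le_rfl)
  have ha1 : 1 ≤ cfA x 1 := one_le_cfA_one hx
  have hax := one_div_eq_cfA_add_gaussMap hx.1
  rw [← hx₁] at hax
  set α : ℕ := cfA x 1 with hα
  have hα1 : (1 : ℝ) ≤ α := by exact_mod_cast ha1
  have hxa : x * (α + x₁) = 1 := by rw [← hax]; field_simp [hx.1.ne']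
  have hc : 1 / (2 * ((M : ℝ) + 1) ^ 2) = m ^ 2 / 2 := by rw [hm]; field_simp
  rw [hc]
  have ht' : (1 : ℝ) ≤ t := by exact_mod_cast ht
  have hk' : (0 : ℝ) ≤ k := by exact_mod_cast hk
  have hxy : x * y ≤ 1 := by nlinarith [hx.1, hx.2, hy.1, hy.2]
  have hkey : ∀ {D : ℝ}, m ^ 2 ≤ D → D ≤ |t * x - k| →
      m ^ 2 / 2 * (1 + x * y) ≤ |t * x - k| * (t + k * y) := by
    intro D h1 h2
    have h3 : (1 : ℝ) ≤ t + k * y := by nlinarith [mul_nonneg hk' hy.1]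
    have h4 : 0 ≤ |t * x - k| := abs_nonneg _
    nlinarith [sq_nonneg m]
  rcases hk.eq_or_lt with rfl | hkpos
  · refine hkey (D := x) (by nlinarith) ?_
    simp only [Int.cast_zero, sub_zero]
    rw [abs_of_nonneg (by nlinarith [hx.1])]
    nlinarith [hx.1]
  have hk1 : (1 : ℝ) ≤ k := by exact_mod_cast hkpos
  by_cases hcase : (t : ℤ) - k * α < 0
  · refine hkey (D := x * x₁) (by nlinarith) ?_
    have h1 : (t : ℝ) ≤ k * α := by
      have : (t : ℤ) ≤ k * α := by linarith
      exact_mod_cast this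
    rw [abs_sub_comm]
    refine le_trans ?_ (le_abs_self _)
    have : (1 : ℝ) - x * α = x * x₁ := by linarith
    nlinarith [mul_le_mul_of_nonneg_right h1 hx.1.le, mul_pos hx.1 hx₁m.1]
  push Not at hcase
  by_cases hkt : (t : ℤ) ≤ k
  · have : k * (α : ℤ) ≤ k * 1 := by nlinarith
    have hα1' : (α : ℤ) = 1 := by
      have h1 : (α : ℤ) ≤ 1 := le_of_mul_le_mul_left this hkpos
      have h2 : (1 : ℤ) ≤ α := by exact_mod_cast ha1
      omega
    have hαr : (α : ℝ) = 1 := by exact_mod_cast hα1'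
    refine hkey (D := x * x₁) (by nlinarith) ?_
    have h1 : (t : ℝ) ≤ k := by exact_mod_cast hkt
    rw [abs_sub_comm]
    refine le_trans ?_ (le_abs_self _)
    rw [hαr] at hxa
    nlinarith [mul_le_mul_of_nonneg_right h1 hx.1.le, mul_pos hx.1 hx₁m.1]
  push Not at hkt
  obtain ⟨n, rfl⟩ := Int.eq_ofNat_of_zero_le hk
  have hαy : 0 < (α : ℝ) + y := by linarith [hy.1]
  have hy₁ : 1 / ((α : ℝ) + y) ∈ Set.Icc (0 : ℝ) 1 :=
    ⟨by positivity, by rw [div_le_one hαy]; linarith [hy.1]⟩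
  have := ih n (by exact_mod_cast hkt) (k := (t : ℤ) - n * α) hx₁m hirr₁ hM₁ hy₁
    (by exact_mod_cast hkpos) hcase
  rw [hc] at this
  push_cast at this ⊢
  have e1 : (n : ℝ) * x₁ - (t - n * α) = -((t * x - n) / x) := by
    have := hx.1.ne'
    field_simp
    linear_combination n * hxa
  have e2 : (n : ℝ) + (t - n * α) * (1 / (α + y)) = (t + n * y) / (α + y) := by
    field_simp; ring
  have e3 : 1 + x₁ * (1 / ((α : ℝ) + y)) = (1 + x * y) / (x * (α + y)) := by
    have := hx.1.ne'
    field_simp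
    linear_combination hxa
  rw [e1, e2, e3, abs_neg, abs_div, abs_of_pos hx.1, ← mul_div_assoc, div_mul_div_comm] at this
  exact (div_le_div_iff_of_pos_right (mul_pos hx.1 hαy)).1 this

theorem BoundedType.exists_badlyApproximable {x : ℝ} (hx : x ∈ Set.Ioo (0 : ℝ) 1)
    (hirr : Irrational x) (hbt : BoundedType x) :
    ∃ c > 0, ∀ t : ℕ, 1 ≤ t → ∀ k : ℤ, c ≤ t * |t * x + k| := by
  obtain ⟨M, hM⟩ := hbt
  refine ⟨min (1 / (2 * ((M : ℝ) + 1) ^ 2)) x, lt_min (by positivity) hx.1, ?_⟩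
  intro t ht k
  have ht' : (1 : ℝ) ≤ t := by exact_mod_cast ht
  rcases le_total 0 (-k) with hk | hk
  · have := badlyApproximable_aux t (y := 0) (k := -k) hx hirr hM ⟨le_rfl, zero_le_one⟩ ht hk
    refine (min_le_left _ _).trans ?_
    push_cast at this
    simp only [mul_zero, add_zero, mul_one, sub_neg_eq_add] at this
    linarith
  · have hk' : (0 : ℝ) ≤ k := by exact_mod_cast (neg_nonpos.1 (by simpa using hk) : (0 : ℤ) ≤ k)
    refine (min_le_right _ _).trans ?_
    have h1 : x ≤ |t * x + k| := le_trans (by nlinarith [hx.1]) (le_abs_self _)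
    nlinarith [hx.1]

end Diophantine

section RotationDensity

/-- Multiples of a badly approximable number are equidistributed at the optimal scale. -/
theorem exists_nat_mul_add_int_mem_Ioo {R c : ℝ} (hc : 0 < c)
    (hR : ∀ t : ℕ, 1 ≤ t → ∀ k : ℤ, c ≤ t * |t * R + k|) {n : ℕ} (hn : 1 ≤ n) {x y : ℝ}
    (hxy : (3 + 2 / c) / n ≤ y - x) :
    ∃ i : ℕ, 1 ≤ i ∧ i ≤ n ∧ ∃ k : ℤ, i * R + k ∈ Set.Ioo x y := by
  obtain ⟨s, hs, hsn⟩ := Real.exists_rat_abs_sub_le_and_den_le R (n := n) hn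
  set d := s.den with hd
  have hd0 : 0 < d := s.den_pos
  have hdr : (0 : ℝ) < d := by exact_mod_cast hd0
  have hnr : (0 : ℝ) < n := by exact_mod_cast hn
  have hsd : (s : ℝ) = s.num / d := by exact_mod_cast (Rat.num_div_den s).symm
  have hcd : c * (n + 1) ≤ d := by
    have h1 := hR d hd0 (-s.num)
    have h2 : |(d : ℝ) * R + ((-s.num : ℤ) : ℝ)| = d * |R - s| := by
      rw [hsd, ← abs_of_pos hdr, ← abs_mul, abs_of_pos hdr]
      congr 1; push_cast; field_simp; ring
    rw [h2] at h1
    have h3 : (d : ℝ) * (d * |R - s|) ≤ d * (d * (1 / ((n + 1) * d))) := by gcongr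
    have h4 : (d : ℝ) * (d * (1 / ((n + 1) * d))) = d / (n + 1) := by field_simp
    have := h1.trans (h3.trans_eq h4)
    rwa [le_div_iff₀ (by positivity)] at this
  set z := (x + y) / 2 with hz
  set m : ℤ := round (d * z) with hm
  have hmz : |(d : ℝ) * z - m| ≤ 1 / 2 := abs_sub_round _
  obtain ⟨u, v, huv⟩ : IsCoprime s.num (d : ℤ) := by
    rw [Int.isCoprime_iff_gcd_eq_one]; exact s.reduced
  have hdz : (0 : ℤ) < d := by exact_mod_cast hd0
  set w : ℤ := (m * u - 1) % d + 1 with hw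
  have hw1 : 1 ≤ w := by have := Int.emod_nonneg (m * u - 1) hdz.ne'; omega
  have hw2 : w ≤ d := by have := Int.emod_lt_of_pos (m * u - 1) hdz; omega
  obtain ⟨e, he⟩ : ∃ e : ℤ, w = m * u - d * e := by
    refine ⟨(m * u - 1) / d, ?_⟩
    have := Int.emod_add_mul_ediv (m * u - 1) d
    rw [hw]; linarith
  obtain ⟨i, hi⟩ := Int.eq_ofNat_of_zero_le (by omega : 0 ≤ w)
  refine ⟨i, by omega, by omega, m * v + e * s.num, ?_⟩
  have hir : (i : ℝ) = m * u - d * e := by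
    have : (i : ℤ) = m * u - d * e := by rw [← he, hi]
    exact_mod_cast this
  have huvr : (u : ℝ) * s.num + v * d = 1 := by exact_mod_cast huv
  have hid : (i : ℝ) ≤ d := by
    have : (i : ℤ) ≤ d := by omega
    exact_mod_cast this
  have heq : (i : ℝ) * R + ((m * v + e * s.num : ℤ) : ℝ) - z =
      i * (R - s) - (d * z - m) / d := by
    rw [hsd]
    push_cast
    rw [show (i : ℝ) * (R - s.num / d) = i * R - i * s.num / d by ring]
    field_simp
    rw [hir]
    linear_combination (m : ℝ) * huvr
  have hb1 : |(i : ℝ) * (R - s)| ≤ 1 / (n + 1) := by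
    rw [abs_mul, Nat.abs_cast]
    calc (i : ℝ) * |R - s| ≤ d * (1 / ((n + 1) * d)) := by gcongr
      _ = 1 / (n + 1) := by field_simp
  have hb2 : |((d : ℝ) * z - m) / d| ≤ 1 / (2 * (c * (n + 1))) := by
    rw [abs_div, abs_of_pos hdr]
    calc |(d : ℝ) * z - m| / d ≤ (1 / 2) / (c * (n + 1)) := by gcongr
      _ = _ := by field_simp
  have hlt : |(i : ℝ) * R + ((m * v + e * s.num : ℤ) : ℝ) - z| < (y - x) / 2 := by
    rw [heq]
    refine (abs_sub _ _).trans_lt ?_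
    have h1 : (1 : ℝ) / (n + 1) ≤ 1 / n := by gcongr; linarith
    have h2 : (1 : ℝ) / (2 * (c * (n + 1))) ≤ 1 / (2 * (c * n)) := by gcongr; linarith
    have h3 : (3 + 2 / c) / n = 3 * (1 / (n : ℝ)) + 4 * (1 / (2 * (c * n))) := by
      field_simp
      ring
    have h4 : (0 : ℝ) < 1 / n := by positivity
    have h5 : (0 : ℝ) < 1 / (2 * (c * n)) := by positivity
    linarith
  rw [abs_lt] at hlt
  constructor <;> linarith [hlt.1, hlt.2]

end RotationDensity

/-- Quantitative data of a degree one circle map with a flat interval `[a, b]`: `F` is a lift,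
`g` its derivative, `H` a monotone semiconjugacy to the translation by the badly approximable
number `R`. -/
structure FlatMapData (F g H : ℝ → ℝ) (a b R ℓ K c : ℝ) : Prop where
  hab : a < b
  hba : b < a + 1
  hℓ : 1 < ℓ
  hK : 1 ≤ K
  hc : 0 < c
  mono : Monotone F
  degree_one : ∀ x, F (x + 1) = F x + 1
  flat : F b = F a
  hasDerivAt : ∀ x, HasDerivAt F (g x) x
  g_add_one : ∀ x, g (x + 1) = g x
  g_nonneg : ∀ x, 0 ≤ g x
  g_le : ∀ x, g x ≤ K
  g_left : ∀ s, 0 < s → g (a - s) ≤ K * s ^ (ℓ - 1)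
  g_right : ∀ s, 0 < s → g (b + s) ≤ K * s ^ (ℓ - 1)
  F_left : ∀ s, 0 < s → s ≤ 1 → s ^ ℓ ≤ K * (F a - F (a - s))
  F_right : ∀ s, 0 < s → s ≤ 1 → s ^ ℓ ≤ K * (F (b + s) - F b)
  g_pos : ∀ x ∈ Set.Ioo b (a + 1), 0 < g x
  log_g_variation : ∀ u v, b < u → u ≤ v → v < a + 1 → |Real.log (g v) - Real.log (g u)| ≤
    K * (Real.log (v - b) - Real.log (u - b) + (Real.log (a + 1 - u) - Real.log (a + 1 - v)))
  no_periodic : ∀ n : ℕ, 1 ≤ n → ∀ (k : ℤ) (x : ℝ), F^[n] x ≠ x + k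
  H_mono : Monotone H
  H_add_one : ∀ x, H (x + 1) = H x + 1
  H_semiconj : ∀ x, H (F x) = H x + R
  badly : ∀ t : ℕ, 1 ≤ t → ∀ k : ℤ, c ≤ t * |t * R + k|

/-- The product of the values of `g` along an orbit of `F` (the derivative of an iterate). -/
def orbitProd (F g : ℝ → ℝ) (n : ℕ) (x : ℝ) : ℝ := ∏ i ∈ Finset.range n, g (F^[i] x)

/-- `A` and `B` are the points of `{Fⁱ(a) + k : 1 ≤ i ≤ N, k ∈ ℤ}` next to the flat interval;
they are images of `a` under `F^p` and `F^q`. -/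
structure IsScale (F : ℝ → ℝ) (a b : ℝ) (N p q : ℕ) (kp kq : ℤ) (A B : ℝ) : Prop where
  one_le_p : 1 ≤ p
  p_le : p ≤ N
  one_le_q : 1 ≤ q
  q_le : q ≤ N
  hA : A = F^[p] a + kp
  hB : B = F^[q] a + kq
  A_lt : A < a
  lt_B : b < B
  gap : ∀ i, 1 ≤ i → i ≤ N → ∀ k : ℤ, F^[i] a + k ≤ A ∨ B ≤ F^[i] a + k

theorem orbitProd_add (F g : ℝ → ℝ) (m n : ℕ) (x : ℝ) :
    orbitProd F g (m + n) x = orbitProd F g m x * orbitProd F g n (F^[m] x) := by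
  simp only [orbitProd, Finset.prod_range_add, ← Function.iterate_add_apply]
  simp only [add_comm]

theorem orbitProd_succ (F g : ℝ → ℝ) (n : ℕ) (x : ℝ) :
    orbitProd F g (n + 1) x = g x * orbitProd F g n (F x) := by
  rw [add_comm, orbitProd_add]; simp [orbitProd]

theorem apply_add_intCast_of_add_one {F : ℝ → ℝ} (hF : ∀ x, F (x + 1) = F x + 1) (x : ℝ)
    (k : ℤ) : F (x + k) = F x + k := by
  induction k using Int.induction_on with
  | zero => simp
  | succ k ih => push_cast at ih ⊢; rw [← add_assoc, hF, ih, add_assoc]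
  | pred k ih =>
    have := hF (x + (-(k : ℝ) - 1))
    rw [show x + (-(k : ℝ) - 1) + 1 = x + -(k : ℝ) by ring] at this
    push_cast at ih ⊢
    rw [ih] at this; linarith

namespace FlatMapData

variable {F g H : ℝ → ℝ} {a b R ℓ K c : ℝ}

theorem F_add_int (h : FlatMapData F g H a b R ℓ K c) (x : ℝ) (k : ℤ) : F (x + k) = F x + k :=
  apply_add_intCast_of_add_one h.degree_one x k

theorem H_add_int (h : FlatMapData F g H a b R ℓ K c) (x : ℝ) (k : ℤ) : H (x + k) = H x + k :=
  apply_add_intCast_of_add_one h.H_add_one x k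

theorem g_add_int (h : FlatMapData F g H a b R ℓ K c) (x : ℝ) (k : ℤ) : g (x + k) = g x := by
  induction k using Int.induction_on with
  | zero => simp
  | succ k ih => push_cast at ih ⊢; rw [← add_assoc, h.g_add_one, ih]
  | pred k ih =>
    have := h.g_add_one (x + (-(k : ℝ) - 1))
    rw [show x + (-(k : ℝ) - 1) + 1 = x + -(k : ℝ) by ring] at this
    push_cast at ih ⊢
    rw [ih] at this; exact this.symm

theorem iterate_add_int (h : FlatMapData F g H a b R ℓ K c) (n : ℕ) (x : ℝ) (k : ℤ) :
    F^[n] (x + k) = F^[n] x + k := by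
  induction n generalizing x with
  | zero => rfl
  | succ n ih => rw [Function.iterate_succ_apply, h.F_add_int, ih, ← Function.iterate_succ_apply]

theorem orbitProd_add_int (h : FlatMapData F g H a b R ℓ K c) (n : ℕ) (x : ℝ) (k : ℤ) :
    orbitProd F g n (x + k) = orbitProd F g n x := by
  simp only [orbitProd, h.iterate_add_int, h.g_add_int]

theorem iterate_mono (h : FlatMapData F g H a b R ℓ K c) (n : ℕ) : Monotone F^[n] :=
  h.mono.iterate n

theorem H_iterate (h : FlatMapData F g H a b R ℓ K c) (n : ℕ) (x : ℝ) :
    H (F^[n] x) = H x + n * R := by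
  induction n generalizing x with
  | zero => simp
  | succ n ih => rw [Function.iterate_succ_apply, ih, h.H_semiconj]; push_cast; ring

theorem lt_of_H_lt (h : FlatMapData F g H a b R ℓ K c) {x y : ℝ} (hxy : H x < H y) : x < y :=
  lt_of_not_ge fun hle => hxy.not_ge (h.H_mono hle)

theorem flat_Icc (h : FlatMapData F g H a b R ℓ K c) {x : ℝ} (hx : x ∈ Set.Icc a b) :
    F x = F a :=
  le_antisymm ((h.mono hx.2).trans_eq h.flat) (h.mono hx.1)

theorem H_b (h : FlatMapData F g H a b R ℓ K c) : H b = H a := by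
  have h1 := h.H_semiconj a
  have h2 := h.H_semiconj b
  rw [h.flat] at h2; linarith

theorem iterate_flat (h : FlatMapData F g H a b R ℓ K c) {n : ℕ} (hn : 1 ≤ n) {x : ℝ}
    (hx : x ∈ Set.Icc a b) : F^[n] x = F^[n] a := by
  obtain ⟨m, rfl⟩ := Nat.exists_eq_add_of_le' hn
  rw [Function.iterate_succ_apply, h.flat_Icc hx, ← Function.iterate_succ_apply]

theorem iterate_ne_Icc (h : FlatMapData F g H a b R ℓ K c) {n : ℕ} (hn : 1 ≤ n) (k : ℤ) :
    F^[n] a + k ∉ Set.Icc a b := by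
  intro hx
  have := h.flat_Icc hx
  rw [h.F_add_int, ← Function.iterate_succ_apply' F n a, Function.iterate_succ_apply] at this
  refine h.no_periodic n hn (-k) (F a) ?_
  push_cast; linarith

theorem hasDerivAt_iterate (h : FlatMapData F g H a b R ℓ K c) (n : ℕ) (x : ℝ) :
    HasDerivAt F^[n] (orbitProd F g n x) x := by
  induction n generalizing x with
  | zero => simpa [orbitProd] using hasDerivAt_id x
  | succ n ih =>
    rw [orbitProd_succ, mul_comm]
    exact (ih (F x)).comp x (h.hasDerivAt x)

theorem continuous_iterate (h : FlatMapData F g H a b R ℓ K c) (n : ℕ) : Continuous F^[n] :=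
  continuous_iff_continuousAt.2 fun x => (h.hasDerivAt_iterate n x).continuousAt

theorem orbitProd_nonneg (h : FlatMapData F g H a b R ℓ K c) (n : ℕ) (x : ℝ) :
    0 ≤ orbitProd F g n x :=
  Finset.prod_nonneg fun _ _ => h.g_nonneg _

theorem reflect_iterate (F : ℝ → ℝ) (n : ℕ) (x : ℝ) :
    (fun x => -F (-x))^[n] x = -F^[n] (-x) := by
  induction n generalizing x with
  | zero => simp
  | succ n ih => rw [Function.iterate_succ_apply, ih]; simp

/-- Conjugation by `x ↦ -x`. -/
theorem reflect (h : FlatMapData F g H a b R ℓ K c) :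
    FlatMapData (fun x => -F (-x)) (fun x => g (-x)) (fun x => -H (-x)) (-b) (-a) (-R) ℓ K c := by
  have hneg : ∀ {f : ℝ → ℝ}, (∀ x, f (x + 1) = f x + 1) → ∀ x, -f (-(x + 1)) = -f (-x) + 1 := by
    intro f hf x
    have := hf (-(x + 1))
    rw [show -(x + 1) + 1 = -x by ring] at this
    linarith
  have hg : ∀ x, g (-(x + 1)) = g (-x) := by
    intro x
    rw [← h.g_add_one (-(x + 1))]; congr 1; ring
  constructor
  · exact neg_lt_neg h.hab
  · linarith [h.hba]
  · exact h.hℓ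
  · exact h.hK
  · exact h.hc
  · exact fun x y hxy => neg_le_neg (h.mono (neg_le_neg hxy))
  · exact hneg h.degree_one
  · simp [h.flat]
  · intro x
    have := ((h.hasDerivAt (-x)).comp x (hasDerivAt_neg x)).neg
    exact this.congr_deriv (by simp)
  · exact hg
  · exact fun x => h.g_nonneg _
  · exact fun x => h.g_le _
  · intro s hs
    have := h.g_right s hs
    rwa [show -(-b - s) = b + s by ring]
  · intro s hs
    have := h.g_left s hs
    rwa [show -(-a + s) = a - s by ring]
  · intro s hs hs1
    have := h.F_right s hs hs1
    rw [show -(-b - s) = b + s by ring, neg_neg]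
    linarith
  · intro s hs hs1
    have := h.F_left s hs hs1
    rw [show -(-a + s) = a - s by ring, neg_neg]
    linarith
  · intro x hx
    have := h.g_pos (-x + 1) ⟨by linarith [hx.2], by linarith [hx.1]⟩
    rwa [h.g_add_one] at this
  · intro u v hu huv hv
    have := h.log_g_variation (-v + 1) (-u + 1) (by linarith) (by linarith) (by linarith)
    rw [h.g_add_one, h.g_add_one] at this
    rw [abs_sub_comm]
    refine this.trans_eq ?_
    rw [show -u + 1 - b = -b + 1 - u by ring, show -v + 1 - b = -b + 1 - v by ring,
      show a + 1 - (-v + 1) = v - -a by ring, show a + 1 - (-u + 1) = u - -a by ring]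
    ring
  · intro n hn k x hx
    rw [reflect_iterate] at hx
    refine h.no_periodic n hn (-k) (-x) ?_
    push_cast; linarith
  · exact fun x y hxy => neg_le_neg (h.H_mono (neg_le_neg hxy))
  · exact hneg h.H_add_one
  · intro x
    simp only [neg_neg, h.H_semiconj]; ring
  · intro t ht k
    have := h.badly t ht (-k)
    rwa [show (t : ℝ) * -R + k = -(t * R + ((-k : ℤ) : ℝ)) by push_cast; ring, abs_neg]

theorem reflect_orbitProd (F g : ℝ → ℝ) (n : ℕ) (x : ℝ) :
    orbitProd (fun x => -F (-x)) (fun x => g (-x)) n x = orbitProd F g n (-x) := by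
  simp [orbitProd, reflect_iterate]

theorem isScale_reflect (h : FlatMapData F g H a b R ℓ K c) {N p q : ℕ} {kp kq : ℤ} {A B : ℝ}
    (hs : IsScale F a b N p q kp kq A B) :
    IsScale (fun x => -F (-x)) (-b) (-a) N q p (-kq) (-kp) (-B) (-A) := by
  have hb : ∀ n, 1 ≤ n → F^[n] b = F^[n] a := fun n hn =>
    h.iterate_flat hn ⟨h.hab.le, le_rfl⟩
  refine ⟨hs.one_le_q, hs.q_le, hs.one_le_p, hs.p_le, ?_, ?_, neg_lt_neg hs.lt_B,
    neg_lt_neg hs.A_lt, ?_⟩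
  · rw [reflect_iterate, neg_neg, hb _ hs.one_le_q, hs.hB]; push_cast; ring
  · rw [reflect_iterate, neg_neg, hb _ hs.one_le_p, hs.hA]; push_cast; ring
  · intro i hi hiN k
    rw [reflect_iterate, neg_neg, hb _ hi]
    have := hs.gap i hi hiN (-k)
    push_cast at this
    rcases this with h1 | h1
    · right; linarith
    · left; linarith

theorem exists_isScale (h : FlatMapData F g H a b R ℓ K c) {N : ℕ} (hN : 1 ≤ N) :
    ∃ (p q : ℕ) (kp kq : ℤ) (A B : ℝ), IsScale F a b N p q kp kq A B := by
  have hne : (Finset.Icc 1 N).Nonempty := ⟨1, by simp [hN]⟩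
  set m : ℕ → ℝ := fun i => F^[i] a + ((⌈a - F^[i] a⌉ - 1 : ℤ) : ℝ) with hm
  have hm1 : ∀ i, m i < a := fun i => by
    have := Int.ceil_lt_add_one (a - F^[i] a)
    simp only [hm]; push_cast; linarith
  have hm2 : ∀ i, a ≤ m i + 1 := fun i => by
    have := Int.le_ceil (a - F^[i] a)
    simp only [hm]; push_cast; linarith
  have hm3 : ∀ i, m i + 1 = F^[i] a + (⌈a - F^[i] a⌉ : ℤ) := fun i => by
    simp only [hm]; push_cast; ring
  obtain ⟨p, hp, hpmax⟩ := Finset.exists_max_image (Finset.Icc 1 N) m hne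
  obtain ⟨q, hq, hqmin⟩ := Finset.exists_min_image (Finset.Icc 1 N) m hne
  rw [Finset.mem_Icc] at hp hq
  refine ⟨p, q, _, _, m p, m q + 1, hp.1, hp.2, hq.1, hq.2, rfl, hm3 q, hm1 p, ?_, ?_⟩
  · by_contra hle
    push Not at hle
    have hh : m q + 1 ∈ Set.Icc a b := ⟨hm2 q, hle⟩
    rw [hm3] at hh
    exact h.iterate_ne_Icc hq.1 _ hh
  · intro i hi hiN k
    have him : i ∈ Finset.Icc 1 N := Finset.mem_Icc.2 ⟨hi, hiN⟩
    rcases le_or_gt k (⌈a - F^[i] a⌉ - 1) with hk | hk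
    · left
      refine le_trans ?_ (hpmax i him)
      simp only [hm]
      gcongr
    · right
      refine (add_le_add_left (hqmin i him) 1).trans ?_
      rw [hm3]
      gcongr
      omega

/-- Before its return time `q`, the left part of the scale does not meet the scale. -/
theorem left_tower (h : FlatMapData F g H a b R ℓ K c) {N p q : ℕ} {kp kq : ℤ} {A B : ℝ}
    (hs : IsScale F a b N p q kp kq A B) {t : ℕ} (ht : 1 ≤ t) (htq : t < q) (k : ℤ) :
    F^[t] a + k ≤ A ∨ B ≤ F^[t] A + k := by
  rcases hs.gap t ht (by have := hs.q_le; omega) k with h1 | h1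
  · exact Or.inl h1
  right
  have hz : F^[t] (F^[q - t] a + ((kq - k : ℤ) : ℝ)) = B - k := by
    rw [h.iterate_add_int, ← Function.iterate_add_apply, Nat.add_sub_cancel' htq.le, hs.hB]
    push_cast; ring
  rcases hs.gap (q - t) (by omega) (by have := hs.q_le; omega) (kq - k) with h2 | h2
  · have := h.iterate_mono t h2
    rw [hz] at this; linarith
  · exfalso
    have h3 : F^[t] a ≤ B - k := by
      rw [← hz]
      exact h.iterate_mono t (by linarith [hs.lt_B, h.hab])
    have h4 : F^[q] a + kq = F^[t] a + k := by rw [← hs.hB]; linarith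
    refine h.no_periodic (q - t) (by omega) (k - kq) (F^[t] a) ?_
    rw [← Function.iterate_add_apply, Nat.sub_add_cancel htq.le]
    push_cast; linarith

theorem scale_bounds (h : FlatMapData F g H a b R ℓ K c) {N p q : ℕ} {kp kq : ℤ} {A B : ℝ}
    (hs : IsScale F a b N p q kp kq A B) : b - 1 < A ∧ a - 1 ≤ A ∧ B < a + 1 := by
  have hN : 1 ≤ N := hs.one_le_p.trans hs.p_le
  have h1 : b - 1 < A := by
    by_contra hle
    push Not at hle
    rcases hs.gap p hs.one_le_p hs.p_le (kp + 1) with h2 | h2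
    · push_cast at h2; linarith [hs.hA]
    · push_cast at h2; linarith [hs.hA, hs.lt_B]
  have h2 : B < a + 1 := by
    by_contra hle
    push Not at hle
    rcases hs.gap q hs.one_le_q hs.q_le (kq - 1) with h2 | h2
    · push_cast at h2; linarith [hs.hB, hs.A_lt]
    · push_cast at h2; linarith [hs.hB]
  exact ⟨h1, by linarith [h.hab], h2⟩

theorem maps_scale_left (h : FlatMapData F g H a b R ℓ K c) {N p q : ℕ} {kp kq : ℤ} {A B : ℝ}
    (hs : IsScale F a b N p q kp kq A B) {x : ℝ} (hx : x ∈ Set.Icc A b) :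
    F^[q] x + kq ∈ Set.Icc A B := by
  have h1 : A ≤ F^[q] A + kq := by
    have : F^[q] A + kq = F^[p] B + kp := by
      rw [hs.hA, hs.hB, h.iterate_add_int, h.iterate_add_int, ← Function.iterate_add_apply,
        ← Function.iterate_add_apply, add_comm p q]
      ring
    rw [this]
    calc A = F^[p] a + kp := hs.hA
      _ ≤ F^[p] B + kp := by
        gcongr; exact h.iterate_mono p (by linarith [hs.lt_B, h.hab])
  refine ⟨h1.trans (by gcongr; exact h.iterate_mono q hx.1), ?_⟩
  rw [hs.hB, ← h.iterate_flat hs.one_le_q (x := b) ⟨h.hab.le, le_rfl⟩]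
  gcongr
  exact h.iterate_mono q hx.2

theorem maps_scale_right (h : FlatMapData F g H a b R ℓ K c) {N p q : ℕ} {kp kq : ℤ} {A B : ℝ}
    (hs : IsScale F a b N p q kp kq A B) {x : ℝ} (hx : x ∈ Set.Icc a B) :
    F^[p] x + kp ∈ Set.Icc A B := by
  have := h.reflect.maps_scale_left (h.isScale_reflect hs) (x := -x)
    ⟨neg_le_neg hx.2, neg_le_neg hx.1⟩
  rw [reflect_iterate, neg_neg] at this
  push_cast at this
  exact ⟨by linarith [this.2], by linarith [this.1]⟩

theorem left_return_time_le (h : FlatMapData F g H a b R ℓ K c) {N p q : ℕ} {kp kq : ℤ}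
    {A B : ℝ} (hs : IsScale F a b N p q kp kq A B) {x : ℝ} (hx : x ∈ Set.Icc A b) {t : ℕ}
    (ht : 1 ≤ t) {k : ℤ} (hxt : F^[t] x + k ∈ Set.Ioo A B) : q ≤ t := by
  by_contra! hlt
  have h1 := h.iterate_mono t hx.1
  have h2 := h.iterate_mono t hx.2
  rw [h.iterate_flat ht (x := b) ⟨h.hab.le, le_rfl⟩] at h2
  rcases h.left_tower hs ht hlt k with h3 | h3
  · linarith [hxt.1]
  · linarith [hxt.2]

theorem right_return_time_le (h : FlatMapData F g H a b R ℓ K c) {N p q : ℕ} {kp kq : ℤ}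
    {A B : ℝ} (hs : IsScale F a b N p q kp kq A B) {x : ℝ} (hx : x ∈ Set.Icc a B) {t : ℕ}
    (ht : 1 ≤ t) {k : ℤ} (hxt : F^[t] x + k ∈ Set.Ioo A B) : p ≤ t := by
  refine h.reflect.left_return_time_le (h.isScale_reflect hs) (x := -x) (k := -k)
    ⟨neg_le_neg hx.2, neg_le_neg hx.1⟩ ht ?_
  rw [reflect_iterate, neg_neg]
  push_cast
  exact ⟨by linarith [hxt.2], by linarith [hxt.1]⟩

/-- Multiplying bounds for the return branches of a scale along an orbit. -/
theorem orbitProd_le_of_returns (h : FlatMapData F g H a b R ℓ K c) {N p q : ℕ} {kp kq : ℤ}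
    {A B : ℝ} (hs : IsScale F a b N p q kp kq A B) {μ : ℝ}
    (hq : ∀ x ∈ Set.Icc A b, K * orbitProd F g (q - 1) (F x) ≤ Real.exp (μ * q))
    (hp : ∀ x ∈ Set.Icc a B, K * orbitProd F g (p - 1) (F x) ≤ Real.exp (μ * p))
    (t : ℕ) : ∀ x ∈ Set.Icc A B, 1 ≤ t → ∀ k : ℤ, F^[t] x + k ∈ Set.Ioo A B →
      K * orbitProd F g (t - 1) (F x) ≤ Real.exp (μ * t) := by
  induction t using Nat.strong_induction_on with
  | _ t ih =>
  intro x hx ht k hxt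
  have hstep : ∀ {s : ℕ} {m : ℤ}, 1 ≤ s → s ≤ t →
      K * orbitProd F g (s - 1) (F x) ≤ Real.exp (μ * s) → F^[s] x + m ∈ Set.Icc A B →
      K * orbitProd F g (t - 1) (F x) ≤ Real.exp (μ * t) := by
    intro s m hs1 hst hbd hm
    rcases hst.eq_or_lt with rfl | hlt
    · exact hbd
    have h1 := ih (t - s) (by omega) (F^[s] x + m) hm (by omega) (k - m) (by
      rw [h.iterate_add_int, ← Function.iterate_add_apply, Nat.sub_add_cancel hst]
      push_cast
      rwa [add_assoc, add_sub_cancel])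
    rw [h.F_add_int, h.orbitProd_add_int] at h1
    have h2 : orbitProd F g (t - 1) (F x) = orbitProd F g (s - 1) (F x) *
        (g (F^[s] x) * orbitProd F g (t - s - 1) (F (F^[s] x))) := by
      rw [← orbitProd_succ, show t - 1 = (s - 1) + (t - s - 1 + 1) by omega, orbitProd_add,
        ← Function.iterate_succ_apply, Nat.succ_eq_add_one, Nat.sub_add_cancel hs1]
    have h3 : K * orbitProd F g (t - 1) (F x) ≤ (K * orbitProd F g (s - 1) (F x)) *
        (K * orbitProd F g (t - s - 1) (F (F^[s] x))) := by
      rw [h2, ← mul_assoc]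
      have hK := h.hK
      have n1 := h.orbitProd_nonneg (s - 1) (F x)
      have n2 := h.orbitProd_nonneg (t - s - 1) (F (F^[s] x))
      gcongr
      exact h.g_le _
    refine h3.trans ?_
    have h4 : Real.exp (μ * t) = Real.exp (μ * s) * Real.exp (μ * ((t - s : ℕ) : ℝ)) := by
      rw [← Real.exp_add, Nat.cast_sub hst]; congr 1; ring
    rw [h4]
    have hK := h.hK
    have n2 := h.orbitProd_nonneg (t - s - 1) (F (F^[s] x))
    gcongr
  rcases le_total x b with hxb | hxb
  · have hx' : x ∈ Set.Icc A b := ⟨hx.1, hxb⟩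
    exact hstep hs.one_le_q (h.left_return_time_le hs hx' ht hxt) (hq x hx')
      (h.maps_scale_left hs hx')
  · have hx' : x ∈ Set.Icc a B := ⟨h.hab.le.trans hxb, hx.2⟩
    exact hstep hs.one_le_p (h.right_return_time_le hs hx' ht hxt) (hp x hx')
      (h.maps_scale_right hs hx')

end FlatMapData

open MeasureTheory in
/-- The total length of non-overlapping subintervals of an interval is at most its length. -/
theorem sum_sub_le_of_nonoverlapping {ι : Type*} (s : Finset ι) (l r : ι → ℝ) {x y : ℝ}
    (hxy : x ≤ y) (hlr : ∀ i ∈ s, l i ≤ r i) (hl : ∀ i ∈ s, x ≤ l i) (hr : ∀ i ∈ s, r i ≤ y)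
    (hd : ∀ i ∈ s, ∀ j ∈ s, i ≠ j → r i ≤ l j ∨ r j ≤ l i) :
    ∑ i ∈ s, (r i - l i) ≤ y - x := by
  have hdisj : (s : Set ι).PairwiseDisjoint fun i => Set.Ioo (l i) (r i) := by
    intro i hi j hj hij
    rw [Function.onFun, Set.disjoint_left]
    rintro z ⟨h1, h2⟩ ⟨h3, h4⟩
    rcases hd i hi j hj hij with h | h <;> linarith
  have h1 := measureReal_biUnion_finset (μ := volume) hdisj (fun i _ => measurableSet_Ioo)
    (fun i _ => by simp)
  have h2 : volume.real (⋃ i ∈ s, Set.Ioo (l i) (r i)) ≤ volume.real (Set.Icc x y) := by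
    refine measureReal_mono ?_ (by simp)
    refine Set.iUnion₂_subset fun i hi z hz => ?_
    exact ⟨(hl i hi).trans hz.1.le, hz.2.le.trans (hr i hi)⟩
  rw [h1, Real.volume_real_Icc_of_le hxy] at h2
  refine le_trans (Finset.sum_le_sum fun i hi => ?_) h2
  rw [Real.volume_real_Ioo_of_le (hlr i hi)]

namespace FlatMapData

variable {F g H : ℝ → ℝ} {a b R ℓ K c : ℝ}

theorem scale_le_add_one (h : FlatMapData F g H a b R ℓ K c) {N p q : ℕ} {kp kq : ℤ} {A B : ℝ}
    (hs : IsScale F a b N p q kp kq A B) : B ≤ A + 1 := by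
  have h1 := (h.scale_bounds hs).2.1
  rcases hs.gap p hs.one_le_p hs.p_le (kp + 1) with h2 | h2
  · push_cast at h2; linarith [hs.hA]
  · push_cast at h2; linarith [hs.hA]

/-- Denjoy distortion bound for the left return branch of a scale. -/
theorem log_orbitProd_sub_le (h : FlatMapData F g H a b R ℓ K c) {N p q : ℕ} {kp kq : ℤ}
    {A B : ℝ} (hs : IsScale F a b N p q kp kq A B) {r : ℝ} (hr : 0 < r) (hrA : r ≤ a - A)
    (hrB : r ≤ B - b) {y v : ℝ} (hy : y ∈ Set.Icc (F A) (F a)) (hv : v ∈ Set.Icc (F A) (F a)) :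
    orbitProd F g (q - 1) y ≤
      orbitProd F g (q - 1) v * Real.exp (2 * K * Real.log (1 / r)) := by
  have hab := h.hab
  have hba := h.hba
  have hAa := hs.A_lt
  have hbB := hs.lt_B
  have hK := h.hK
  obtain ⟨hA1, hA2, hB1⟩ := h.scale_bounds hs
  have hBA := h.scale_le_add_one hs
  set k : ℕ → ℤ := fun i => ⌈a - F^[i + 1] a⌉ with hk
  have hk1 : ∀ i, a ≤ F^[i + 1] a + k i := fun i => by
    have := Int.le_ceil (a - F^[i + 1] a)
    simp only [hk]; linarith
  have hk2 : ∀ i, F^[i + 1] a + k i < a + 1 := fun i => by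
    have := Int.ceil_lt_add_one (a - F^[i + 1] a)
    simp only [hk]; linarith
  set lo : ℕ → ℝ := fun i => F^[i + 1] A + k i with hlo
  set hi : ℕ → ℝ := fun i => F^[i + 1] a + k i with hhi
  have hBlo : ∀ i ∈ Finset.range (q - 1), B ≤ lo i := by
    intro i hiq
    rw [Finset.mem_range] at hiq
    rcases h.left_tower hs (t := i + 1) (by omega) (by omega) (k i) with h1 | h1
    · linarith [hk1 i]
    · exact h1
  have hhiA : ∀ i ∈ Finset.range (q - 1), hi i ≤ A + 1 := by
    intro i hiq
    rw [Finset.mem_range] at hiq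
    rcases h.left_tower hs (t := i + 1) (by omega) (by omega) (k i - 1) with h1 | h1
    · push_cast at h1; simp only [hhi]; linarith
    · have := h.iterate_mono (i + 1) hAa.le
      push_cast at h1; linarith [hk2 i]
  have hlohi : ∀ i, lo i ≤ hi i := fun i => by
    simp only [hlo, hhi]; gcongr; exact h.iterate_mono _ hAa.le
  have hmem : ∀ z ∈ Set.Icc (F A) (F a), ∀ i, F^[i] z + k i ∈ Set.Icc (lo i) (hi i) := by
    intro z hz i
    simp only [hlo, hhi, Function.iterate_succ_apply]
    exact ⟨by gcongr; exact h.iterate_mono i hz.1, by gcongr; exact h.iterate_mono i hz.2⟩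
  have hover : ∀ i j, i < j → j < q - 1 → hi i ≤ lo j ∨ hi j ≤ lo i := by
    intro i j hij hj
    have hpt : ∀ x, F^[i + 1] (F^[j - i] x + ((k j - k i : ℤ) : ℝ)) + k i = F^[j + 1] x + k j := by
      intro x
      rw [h.iterate_add_int, ← Function.iterate_add_apply, show i + 1 + (j - i) = j + 1 by omega]
      push_cast; ring
    rcases h.left_tower hs (t := j - i) (by omega) (by omega) (k j - k i) with h1 | h1
    · right
      have := h.iterate_mono (i + 1) h1
      simp only [hlo, hhi]
      rw [← hpt]; gcongr
    · left
      have := h.iterate_mono (i + 1) (show a ≤ _ from (by linarith : a ≤ B).trans h1)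
      simp only [hlo, hhi]
      rw [← hpt]; gcongr
  set G : ℝ → ℝ := fun x => K * (Real.log (x - b) - Real.log (a + 1 - x)) with hG
  have hGmono : ∀ u v, b < u → u ≤ v → v < a + 1 → G u ≤ G v := by
    intro u v hu huv hv
    have e1 : Real.log (u - b) ≤ Real.log (v - b) :=
      Real.log_le_log (by linarith) (by linarith)
    have e2 : Real.log (a + 1 - v) ≤ Real.log (a + 1 - u) :=
      Real.log_le_log (by linarith) (by linarith)
    simp only [hG]; gcongr
  have hvar : ∀ u v, b < u → u ≤ v → v < a + 1 →
      |Real.log (g v) - Real.log (g u)| ≤ G v - G u := by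
    intro u v hu huv hv
    refine (h.log_g_variation u v hu huv hv).trans_eq ?_
    simp only [hG]; ring
  have hsum : ∑ i ∈ Finset.range (q - 1), (G (hi i) - G (lo i)) ≤ G (A + 1) - G B := by
    apply sum_sub_le_of_nonoverlapping (Finset.range (q - 1)) (G ∘ lo) (G ∘ hi)
    · exact hGmono _ _ hbB hBA (by linarith)
    · intro i hiq
      exact hGmono _ _ (by linarith [hBlo i hiq]) (hlohi i) (by linarith [hhiA i hiq])
    · intro i hiq
      exact hGmono _ _ hbB (hBlo i hiq) (by linarith [hhiA i hiq, hlohi i])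
    · intro i hiq
      exact hGmono _ _ (by linarith [hBlo i hiq, hlohi i]) (hhiA i hiq) (by linarith)
    · have key : ∀ i ∈ Finset.range (q - 1), ∀ j ∈ Finset.range (q - 1), hi i ≤ lo j →
          G (hi i) ≤ G (lo j) := by
        intro i hiq j hjq hle
        exact hGmono _ _ (by linarith [hBlo i hiq, hlohi i]) hle
          (by linarith [hhiA j hjq, hlohi j])
      intro i hiq j hjq hij
      have hiq' := Finset.mem_range.1 hiq
      have hjq' := Finset.mem_range.1 hjq
      rcases lt_or_gt_of_ne hij with hlt | hlt
      · exact (hover i j hlt hjq').imp (key i hiq j hjq) (key j hjq i hiq)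
      · exact (hover j i hlt hiq').symm.imp (key i hiq j hjq) (key j hjq i hiq)
  have hGle : G (A + 1) - G B ≤ 2 * K * Real.log (1 / r) := by
    have e1 : Real.log (A + 1 - b) ≤ 0 := Real.log_nonpos (by linarith) (by linarith)
    have e2 : Real.log (a + 1 - B) ≤ 0 := Real.log_nonpos (by linarith) (by linarith)
    have e3 : Real.log r ≤ Real.log (a - A) := Real.log_le_log hr hrA
    have e4 : Real.log r ≤ Real.log (B - b) := Real.log_le_log hr hrB
    have e5 : a + 1 - (A + 1) = a - A := by ring
    simp only [hG, one_div, Real.log_inv, e5]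
    have : K * ((Real.log (A + 1 - b) - Real.log (a - A)) -
        (Real.log (B - b) - Real.log (a + 1 - B))) ≤ K * (-2 * Real.log r) := by
      gcongr; linarith
    linarith
  have hgpos : ∀ z ∈ Set.Icc (F A) (F a), ∀ i ∈ Finset.range (q - 1), 0 < g (F^[i] z) := by
    intro z hz i hiq
    have hm := hmem z hz i
    rw [← h.g_add_int _ (k i)]
    exact h.g_pos _ ⟨by linarith [hBlo i hiq, hm.1], by linarith [hhiA i hiq, hm.2]⟩
  have hlog : ∀ i ∈ Finset.range (q - 1),
      Real.log (g (F^[i] y)) - Real.log (g (F^[i] v)) ≤ G (hi i) - G (lo i) := by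
    intro i hiq
    have hmy := hmem y hy i
    have hmv := hmem v hv i
    have b1 := hBlo i hiq
    have b2 := hhiA i hiq
    rw [← h.g_add_int (F^[i] y) (k i), ← h.g_add_int (F^[i] v) (k i)]
    have m1 : ∀ z ∈ Set.Icc (lo i) (hi i), G z ∈ Set.Icc (G (lo i)) (G (hi i)) := fun z hz =>
      ⟨hGmono _ _ (by linarith) hz.1 (by linarith [hz.2]),
        hGmono _ _ (by linarith [hz.1]) hz.2 (by linarith)⟩
    have my := m1 _ hmy
    have mv := m1 _ hmv
    rcases le_total (F^[i] v + k i) (F^[i] y + k i) with hle | hle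
    · have := hvar _ _ (by linarith [hmv.1]) hle (by linarith [hmy.2])
      have := le_of_abs_le this
      linarith [my.2, mv.1]
    · have := hvar _ _ (by linarith [hmy.1]) hle (by linarith [hmv.2])
      have := neg_le_of_abs_le this
      linarith [my.1, mv.2]
  have hexp : ∀ z ∈ Set.Icc (F A) (F a), orbitProd F g (q - 1) z =
      Real.exp (∑ i ∈ Finset.range (q - 1), Real.log (g (F^[i] z))) := by
    intro z hz
    rw [Real.exp_sum, orbitProd]
    exact Finset.prod_congr rfl fun i hiq => (Real.exp_log (hgpos z hz i hiq)).symm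
  rw [hexp y hy, hexp v hv, ← Real.exp_add, Real.exp_le_exp]
  have := Finset.sum_le_sum hlog
  rw [Finset.sum_sub_distrib] at this
  linarith

/-- The derivative of the left return branch of a scale is polynomially bounded in terms of the
width of the scale. -/
theorem orbitProd_left_le (h : FlatMapData F g H a b R ℓ K c) {N p q : ℕ} {kp kq : ℤ}
    {A B : ℝ} (hs : IsScale F a b N p q kp kq A B) {r : ℝ} (hr : 0 < r) (hrA : r ≤ a - A)
    (hrB : r ≤ B - b) {u : ℝ} (hu : u ∈ Set.Icc A b) :
    K * orbitProd F g (q - 1) (F u) ≤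
      Real.exp ((2 * Real.log K + ℓ + 2 * K) * (Real.log (1 / r) + 1)) := by
  have hab := h.hab
  have hAa := hs.A_lt
  have hK := h.hK
  have hℓ := h.hℓ
  obtain ⟨hA1, hA2, hB1⟩ := h.scale_bounds hs
  have hlK : 0 ≤ Real.log K := Real.log_nonneg hK
  have hr1 : r ≤ 1 := by linarith
  have hlr : 0 ≤ Real.log (1 / r) := Real.log_nonneg (by rw [le_div_iff₀ hr]; linarith)
  have hrpow : (a - A) ^ ℓ ≤ K * (F a - F A) := by
    have := h.F_left (a - A) (by linarith) (by linarith)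
    rwa [sub_sub_cancel] at this
  have hpos : 0 < (a - A) ^ ℓ := Real.rpow_pos_of_pos (by linarith) _
  have hFlt : F A < F a := by
    by_contra! hle
    nlinarith
  obtain ⟨v, hv, hveq⟩ := exists_hasDerivAt_eq_slope (F^[q - 1]) (orbitProd F g (q - 1)) hFlt
    (h.continuous_iterate _).continuousOn fun x _ => h.hasDerivAt_iterate _ x
  have hy : F u ∈ Set.Icc (F A) (F a) := by
    refine ⟨h.mono hu.1, ?_⟩
    rw [← h.flat]; exact h.mono hu.2
  have h1 := h.log_orbitProd_sub_le hs hr hrA hrB hy ⟨hv.1.le, hv.2.le⟩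
  have h2 : F^[q - 1] (F a) - F^[q - 1] (F A) ≤ 1 := by
    have := h.iterate_mono (q - 1) (h.mono (by linarith : a ≤ A + 1))
    rw [h.degree_one] at this
    have e := h.iterate_add_int (q - 1) (F A) 1
    push_cast at e
    linarith
  have h3 : orbitProd F g (q - 1) v ≤ K * Real.exp (ℓ * Real.log (1 / r)) := by
    rw [hveq, div_le_iff₀ (by linarith)]
    have e1 : r ^ ℓ ≤ (a - A) ^ ℓ := Real.rpow_le_rpow hr.le hrA (by linarith)
    have e2 : Real.exp (ℓ * Real.log (1 / r)) * r ^ ℓ = 1 := by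
      rw [Real.rpow_def_of_pos hr, ← Real.exp_add, one_div, Real.log_inv]
      ring_nf; simp
    calc _ ≤ (1 : ℝ) := h2
      _ = Real.exp (ℓ * Real.log (1 / r)) * r ^ ℓ := e2.symm
      _ ≤ Real.exp (ℓ * Real.log (1 / r)) * (K * (F a - F A)) := by
        gcongr; exact e1.trans hrpow
      _ = _ := by ring
  calc K * orbitProd F g (q - 1) (F u)
      ≤ K * (K * Real.exp (ℓ * Real.log (1 / r)) * Real.exp (2 * K * Real.log (1 / r))) := by
        gcongr
        exact h1.trans (by gcongr)
    _ = Real.exp (2 * Real.log K + ℓ * Real.log (1 / r) + 2 * K * Real.log (1 / r)) := by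
        rw [Real.exp_add, Real.exp_add, two_mul (Real.log K), Real.exp_add,
          Real.exp_log (by linarith)]
        ring
    _ ≤ _ := by
        rw [Real.exp_le_exp]
        nlinarith [mul_nonneg hlK hlr]

theorem orbitProd_right_le (h : FlatMapData F g H a b R ℓ K c) {N p q : ℕ} {kp kq : ℤ}
    {A B : ℝ} (hs : IsScale F a b N p q kp kq A B) {r : ℝ} (hr : 0 < r) (hrA : r ≤ a - A)
    (hrB : r ≤ B - b) {u : ℝ} (hu : u ∈ Set.Icc a B) :
    K * orbitProd F g (p - 1) (F u) ≤
      Real.exp ((2 * Real.log K + ℓ + 2 * K) * (Real.log (1 / r) + 1)) := by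
  have := h.reflect.orbitProd_left_le (h.isScale_reflect hs) hr (by linarith) (by linarith)
    (u := -u) ⟨neg_le_neg hu.2, neg_le_neg hu.1⟩
  rwa [reflect_orbitProd, neg_neg, neg_neg] at this

end FlatMapData

/-- A bootstrap: a bound which either improves by a definite factor or is comparable to the
inverse of the scale decays geometrically along the scales `D ^ j`. -/
theorem exists_geometric_bound {Λ : ℕ → ℝ → Prop} (hΛ : ∀ N μ ν, μ ≤ ν → Λ N μ → Λ N ν)
    {D : ℕ} (hD : 2 ≤ D) {γ κ μ₀ : ℝ} (hγ : 0 < γ) (hκ : 0 < κ) (h0 : Λ 1 μ₀)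
    (hstep : ∀ N μ, 1 ≤ N → Λ N μ → ∃ L : ℝ, 0 ≤ L ∧ Λ (D * N) (μ - γ * L / (D * N)) ∧
      Λ (D * N) (κ * (L + 1) / N)) :
    ∃ Q > 0, ∃ θ ∈ Set.Ioo (0 : ℝ) 1, 1 < D * θ ∧ ∀ j : ℕ, Λ (D ^ j) (Q * θ ^ j) := by
  have hDr : (2 : ℝ) ≤ D := by exact_mod_cast hD
  set η : ℝ := 1 / (4 * κ) with hη
  have hη0 : 0 < η := by positivity
  set θ : ℝ := max (3 / 4) (1 - γ * η / D) with hθ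
  have hθ1 : θ < 1 := max_lt (by norm_num) (by linarith [show 0 < γ * η / D by positivity])
  have hθ2 : 3 / 4 ≤ θ := le_max_left _ _
  have hθ3 : 1 - γ * η / D ≤ θ := le_max_right _ _
  set Q : ℝ := max μ₀ (4 * κ) with hQ
  have hQ1 : 4 * κ ≤ Q := le_max_right _ _
  have hQ0 : 0 < Q := by linarith
  have hDθ : 1 < D * θ := by nlinarith
  refine ⟨Q, hQ0, θ, ⟨by linarith, hθ1⟩, hDθ, fun j => ?_⟩
  induction j with
  | zero => simpa using hΛ 1 _ _ (le_max_left _ _) h0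
  | succ j ih =>
    have hN : 1 ≤ D ^ j := Nat.one_le_pow _ _ (by omega)
    obtain ⟨L, hL, h1, h2⟩ := hstep _ _ hN ih
    set μ := Q * θ ^ j with hμ
    have hμ0 : 0 < μ := by have : 0 < θ := by linarith
                           positivity
    have hNr : (0 : ℝ) < (D : ℝ) ^ j := by positivity
    have hμN : Q ≤ μ * (D : ℝ) ^ j := by
      rw [hμ, mul_assoc, ← mul_pow, mul_comm θ]
      exact le_mul_of_one_le_right hQ0.le (one_le_pow₀ hDθ.le)
    have hgoal : Q * θ ^ (j + 1) = θ * μ := by rw [hμ]; ring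
    rw [hgoal, pow_succ, mul_comm]
    push_cast at h1 h2
    rcases le_total (η * μ * (D : ℝ) ^ j) L with hle | hle
    · refine hΛ _ _ _ ?_ h1
      have : γ * (η * μ * (D : ℝ) ^ j) / (D * (D : ℝ) ^ j) ≤ γ * L / (D * (D : ℝ) ^ j) := by
        gcongr
      have e : γ * (η * μ * (D : ℝ) ^ j) / (D * (D : ℝ) ^ j) = γ * η / D * μ := by
        field_simp
      rw [e] at this
      nlinarith
    · refine hΛ _ _ _ ?_ h2
      rw [div_le_iff₀ hNr]
      have e : κ * (η * μ * (D : ℝ) ^ j) = μ * (D : ℝ) ^ j / 4 := by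
        rw [hη]; field_simp
      have : κ * (L + 1) ≤ κ * (η * μ * (D : ℝ) ^ j) + κ := by nlinarith
      nlinarith [mul_pos hμ0 hNr]

/-- The return branches of some scale of level `N` have exponential rate at most `μ`. -/
def ScaleBound (F g : ℝ → ℝ) (a b K : ℝ) (N : ℕ) (μ : ℝ) : Prop :=
  ∃ (p q : ℕ) (kp kq : ℤ) (A B : ℝ), IsScale F a b N p q kp kq A B ∧
    (∀ x ∈ Set.Icc A b, K * orbitProd F g (q - 1) (F x) ≤ Real.exp (μ * q)) ∧
    ∀ x ∈ Set.Icc a B, K * orbitProd F g (p - 1) (F x) ≤ Real.exp (μ * p)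

theorem ScaleBound.mono {F g : ℝ → ℝ} {a b K : ℝ} {N : ℕ} {μ ν : ℝ} (hμ : μ ≤ ν)
    (h : ScaleBound F g a b K N μ) : ScaleBound F g a b K N ν := by
  obtain ⟨p, q, kp, kq, A, B, hs, hq, hp⟩ := h
  refine ⟨p, q, kp, kq, A, B, hs, fun x hx => (hq x hx).trans ?_, fun x hx => (hp x hx).trans ?_⟩
  all_goals gcongr

namespace FlatMapData

variable {F g H : ℝ → ℝ} {a b R ℓ K c : ℝ}

theorem exists_iterate_mem_of_H (h : FlatMapData F g H a b R ℓ K c) {n : ℕ} (hn : 1 ≤ n)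
    {y z : ℝ} (hyz : (3 + 2 / c) / n ≤ H z - H y) (x : ℝ) :
    ∃ i : ℕ, 1 ≤ i ∧ i ≤ n ∧ ∃ k : ℤ, F^[i] x + k ∈ Set.Ioo y z := by
  obtain ⟨i, hi, hin, k, hk⟩ := exists_nat_mul_add_int_mem_Ioo h.hc h.badly hn
    (x := H y - H x) (y := H z - H x) (by linarith)
  have hH : H (F^[i] x + k) = H x + i * R + k := by rw [h.H_add_int, h.H_iterate]
  exact ⟨i, hi, hin, k, h.lt_of_H_lt (by linarith [hk.1]), h.lt_of_H_lt (by linarith [hk.2])⟩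

theorem le_mul_H_left (h : FlatMapData F g H a b R ℓ K c) {N p q : ℕ} {kp kq : ℤ} {A B : ℝ}
    (hs : IsScale F a b N p q kp kq A B) : c ≤ p * (H a - H A) := by
  have h1 := h.badly p hs.one_le_p kp
  have h2 := h.H_mono hs.A_lt.le
  have h3 : p * R + kp = H A - H a := by rw [hs.hA, h.H_add_int, h.H_iterate]; ring
  rwa [h3, abs_sub_comm, abs_of_nonneg (by linarith)] at h1

theorem mul_H_left_lt (h : FlatMapData F g H a b R ℓ K c) {N p q : ℕ} {kp kq : ℤ} {A B : ℝ}
    (hs : IsScale F a b N p q kp kq A B) : N * (H a - H A) < 3 + 2 / c := by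
  have hN : 1 ≤ N := hs.one_le_p.trans hs.p_le
  have hNr : (0 : ℝ) < N := by exact_mod_cast hN
  by_contra! hle
  obtain ⟨i, hi, hiN, k, hk⟩ := h.exists_iterate_mem_of_H hN (y := A) (z := a)
    (by rw [div_le_iff₀ hNr]; linarith) a
  rcases hs.gap i hi hiN k with h1 | h1
  · linarith [hk.1]
  · linarith [hk.2, hs.lt_B, h.hab]

theorem le_mul_H_right (h : FlatMapData F g H a b R ℓ K c) {N p q : ℕ} {kp kq : ℤ} {A B : ℝ}
    (hs : IsScale F a b N p q kp kq A B) : c ≤ q * (H B - H b) := by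
  have := h.reflect.le_mul_H_left (h.isScale_reflect hs)
  simp only [neg_neg] at this
  linarith

theorem le_mul_p (h : FlatMapData F g H a b R ℓ K c) {N p q : ℕ} {kp kq : ℤ} {A B : ℝ}
    (hs : IsScale F a b N p q kp kq A B) : c * N ≤ (3 + 2 / c) * p := by
  have h1 := h.le_mul_H_left hs
  have h2 := h.mul_H_left_lt hs
  have hp : (0 : ℝ) ≤ p := by positivity
  have hN : (0 : ℝ) ≤ N := by positivity
  nlinarith

theorem le_mul_q (h : FlatMapData F g H a b R ℓ K c) {N p q : ℕ} {kp kq : ℤ} {A B : ℝ}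
    (hs : IsScale F a b N p q kp kq A B) : c * N ≤ (3 + 2 / c) * q :=
  h.reflect.le_mul_p (h.isScale_reflect hs)

/-- Scales of much higher level are strictly nested. -/
theorem scale_lt_left (h : FlatMapData F g H a b R ℓ K c) {N p q N' p' q' : ℕ}
    {kp kq kp' kq' : ℤ} {A B A' B' : ℝ} (hs : IsScale F a b N p q kp kq A B)
    (hs' : IsScale F a b N' p' q' kp' kq' A' B') (hN : (3 + 2 / c) * N ≤ c * N') : A < A' := by
  have h1 := h.le_mul_H_left hs
  have h2 := h.mul_H_left_lt hs'
  have h0 := h.H_mono hs.A_lt.le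
  have hN0 : (0 : ℝ) < N := by exact_mod_cast hs.one_le_p.trans hs.p_le
  have hN0' : (0 : ℝ) < N' := by exact_mod_cast hs'.one_le_p.trans hs'.p_le
  have hp : (p : ℝ) ≤ N := by exact_mod_cast hs.p_le
  refine h.lt_of_H_lt ?_
  by_contra! hle
  have hc := h.hc
  have e1 : c ≤ N * (H a - H A) := h1.trans (mul_le_mul_of_nonneg_right hp (by linarith))
  have e2 : c * N' ≤ N' * (N * (H a - H A)) := by nlinarith
  have e3 : N' * (N * (H a - H A)) ≤ N * (N' * (H a - H A')) := by
    rw [mul_left_comm]; gcongr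
  have e4 : N * (N' * (H a - H A')) < N * (3 + 2 / c) := by gcongr
  linarith

theorem scale_lt_right (h : FlatMapData F g H a b R ℓ K c) {N p q N' p' q' : ℕ}
    {kp kq kp' kq' : ℤ} {A B A' B' : ℝ} (hs : IsScale F a b N p q kp kq A B)
    (hs' : IsScale F a b N' p' q' kp' kq' A' B') (hN : (3 + 2 / c) * N ≤ c * N') : B' < B := by
  have := h.reflect.scale_lt_left (h.isScale_reflect hs) (h.isScale_reflect hs') hN
  linarith

theorem exists_visit_left (h : FlatMapData F g H a b R ℓ K c) {N p q E : ℕ} {kp kq : ℤ}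
    {A B : ℝ} (hs : IsScale F a b N p q kp kq A B) (hE : 3 + 2 / c ≤ c * E) (x : ℝ) :
    ∃ τ : ℕ, 1 ≤ τ ∧ τ ≤ E * N ∧ ∃ k : ℤ, F^[τ] x + k ∈ Set.Ioo A B ∧
      g (F^[τ] x) ≤ K * (a - A) ^ (ℓ - 1) := by
  have hN : 1 ≤ N := hs.one_le_p.trans hs.p_le
  have hN0 : (0 : ℝ) < N := by exact_mod_cast hN
  have hc := h.hc
  have hE0 : 0 < E := by
    rcases Nat.eq_zero_or_pos E with rfl | hpos
    · have : 0 < 2 / c := by positivity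
      push_cast at hE; linarith
    · exact hpos
  have hp : (p : ℝ) ≤ N := by exact_mod_cast hs.p_le
  have h1 : c ≤ N * (H a - H A) :=
    (h.le_mul_H_left hs).trans
      (mul_le_mul_of_nonneg_right hp (by linarith [h.H_mono hs.A_lt.le]))
  obtain ⟨τ, hτ, hτE, k, hk⟩ := h.exists_iterate_mem_of_H (n := E * N)
    (Nat.mul_pos hE0 hN) (y := A) (z := a) (by
      have : (0 : ℝ) < E := by exact_mod_cast hE0
      push_cast
      rw [div_le_iff₀ (by positivity)]
      nlinarith) x
  refine ⟨τ, hτ, hτE, k, ⟨hk.1, by linarith [hk.2, h.hab, hs.lt_B]⟩, ?_⟩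
  have h2 := h.g_left (a - (F^[τ] x + k)) (by linarith [hk.2])
  rw [sub_sub_cancel, h.g_add_int] at h2
  have hK := h.hK
  have hℓ := h.hℓ
  refine h2.trans ?_
  gcongr
  · linarith [hk.2]
  · exact hk.1.le

theorem exists_visit_right (h : FlatMapData F g H a b R ℓ K c) {N p q E : ℕ} {kp kq : ℤ}
    {A B : ℝ} (hs : IsScale F a b N p q kp kq A B) (hE : 3 + 2 / c ≤ c * E) (x : ℝ) :
    ∃ τ : ℕ, 1 ≤ τ ∧ τ ≤ E * N ∧ ∃ k : ℤ, F^[τ] x + k ∈ Set.Ioo A B ∧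
      g (F^[τ] x) ≤ K * (B - b) ^ (ℓ - 1) := by
  obtain ⟨τ, h1, h2, k, h3, h4⟩ :=
    h.reflect.exists_visit_left (h.isScale_reflect hs) hE (-x)
  rw [reflect_iterate, neg_neg] at h3 h4
  refine ⟨τ, h1, h2, -k, ?_, ?_⟩
  · push_cast
    exact ⟨by linarith [h3.2], by linarith [h3.1]⟩
  · rwa [neg_neg, show -b - -B = B - b by ring] at h4

/-- One passage near the flat interval yields a definite contraction. -/
theorem orbitProd_left_le_of_visit (h : FlatMapData F g H a b R ℓ K c) {N p q N' p' q' E : ℕ}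
    {kp kq kp' kq' : ℤ} {A B A' B' : ℝ} (hs : IsScale F a b N p q kp kq A B)
    (hs' : IsScale F a b N' p' q' kp' kq' A' B') (hA : A < A') (hB : B' < B)
    (hEq : E * N < q') {μ r : ℝ} (hr : 0 < r)
    (hvisit : ∀ x, ∃ τ : ℕ, 1 ≤ τ ∧ τ ≤ E * N ∧ ∃ k : ℤ, F^[τ] x + k ∈ Set.Ioo A B ∧
      g (F^[τ] x) ≤ K * r ^ (ℓ - 1))
    (hq : ∀ x ∈ Set.Icc A b, K * orbitProd F g (q - 1) (F x) ≤ Real.exp (μ * q))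
    (hp : ∀ x ∈ Set.Icc a B, K * orbitProd F g (p - 1) (F x) ≤ Real.exp (μ * p))
    {x : ℝ} (hx : x ∈ Set.Icc A' b) :
    K * orbitProd F g (q' - 1) (F x) ≤
      Real.exp (μ * q' - (ℓ - 1) * Real.log (1 / r)) := by
  obtain ⟨τ, hτ, hτE, k, hmem, hgτ⟩ := hvisit x
  have hτq : τ < q' := by omega
  have hbB := hs.lt_B
  have hxAB : x ∈ Set.Icc A B := ⟨by linarith [hx.1], by linarith [hx.2]⟩
  have hb1 := h.orbitProd_le_of_returns hs hq hp τ x hxAB hτ k hmem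
  have hret := h.maps_scale_left hs' hx
  have hb2 := h.orbitProd_le_of_returns hs hq hp (q' - τ) (F^[τ] x + k)
    ⟨hmem.1.le, hmem.2.le⟩ (by omega) (kq' - k) (by
      rw [h.iterate_add_int, ← Function.iterate_add_apply, Nat.sub_add_cancel hτq.le]
      push_cast
      rw [add_assoc, add_sub_cancel]
      exact ⟨by linarith [hret.1], by linarith [hret.2]⟩)
  rw [h.F_add_int, h.orbitProd_add_int] at hb2
  have hsplit : orbitProd F g (q' - 1) (F x) = orbitProd F g (τ - 1) (F x) *
      (g (F^[τ] x) * orbitProd F g (q' - τ - 1) (F (F^[τ] x))) := by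
    rw [← orbitProd_succ, show q' - 1 = (τ - 1) + (q' - τ - 1 + 1) by omega, orbitProd_add,
      ← Function.iterate_succ_apply, Nat.succ_eq_add_one, Nat.sub_add_cancel hτ]
  have hK := h.hK
  have n1 := h.orbitProd_nonneg (τ - 1) (F x)
  have n2 := h.orbitProd_nonneg (q' - τ - 1) (F (F^[τ] x))
  have hexp : Real.exp (μ * q' - (ℓ - 1) * Real.log (1 / r)) =
      Real.exp (μ * τ) * Real.exp (μ * ((q' - τ : ℕ) : ℝ)) * r ^ (ℓ - 1) := by
    rw [Real.rpow_def_of_pos hr, ← Real.exp_add, ← Real.exp_add, Nat.cast_sub hτq.le, one_div,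
      Real.log_inv]
    congr 1; ring
  rw [hexp, hsplit]
  calc K * (orbitProd F g (τ - 1) (F x) *
        (g (F^[τ] x) * orbitProd F g (q' - τ - 1) (F (F^[τ] x))))
      ≤ K * (orbitProd F g (τ - 1) (F x) *
        (K * r ^ (ℓ - 1) * orbitProd F g (q' - τ - 1) (F (F^[τ] x)))) := by gcongr
    _ = (K * orbitProd F g (τ - 1) (F x)) * (K * orbitProd F g (q' - τ - 1) (F (F^[τ] x))) *
        r ^ (ℓ - 1) := by ring
    _ ≤ _ := by gcongr

theorem scaleBound_refine (h : FlatMapData F g H a b R ℓ K c) {N p q E D : ℕ} {kp kq : ℤ}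
    {A B : ℝ} (hs : IsScale F a b N p q kp kq A B) (hE : 3 + 2 / c ≤ c * E)
    (hD : (3 + 2 / c) * (E + 1) ≤ c * D) {μ r : ℝ} (hr : r = min (a - A) (B - b))
    (hq : ∀ x ∈ Set.Icc A b, K * orbitProd F g (q - 1) (F x) ≤ Real.exp (μ * q))
    (hp : ∀ x ∈ Set.Icc a B, K * orbitProd F g (p - 1) (F x) ≤ Real.exp (μ * p)) :
    ScaleBound F g a b K (D * N) (μ - (ℓ - 1) * Real.log (1 / r) / (D * N)) := by
  have hc := h.hc
  have hC : 0 < 3 + 2 / c := by positivity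
  have hAa := hs.A_lt
  have hbB := hs.lt_B
  have hab := h.hab
  have hr0 : 0 < r := by rw [hr]; exact lt_min (by linarith) (by linarith)
  have hr1 : r ≤ 1 := by
    rw [hr]; exact (min_le_left _ _).trans (by linarith [(h.scale_bounds hs).2.1])
  have hlr : 0 ≤ Real.log (1 / r) := Real.log_nonneg (by rw [le_div_iff₀ hr0]; linarith)
  have hN : 1 ≤ N := hs.one_le_p.trans hs.p_le
  have hN0 : (0 : ℝ) < N := by exact_mod_cast hN
  have hE0 : (0 : ℝ) ≤ E := by positivity
  have hD0 : (0 : ℝ) < D := by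
    by_contra! hle
    nlinarith
  have hDN : 1 ≤ D * N := Nat.mul_pos (by exact_mod_cast hD0) hN
  obtain ⟨p', q', kp', kq', A', B', hs'⟩ := h.exists_isScale hDN
  have hnest : (3 + 2 / c) * N ≤ c * ((D * N : ℕ) : ℝ) := by
    push_cast
    nlinarith [mul_nonneg hC.le hE0]
  have hlarge : ∀ m : ℕ, c * ((D * N : ℕ) : ℝ) ≤ (3 + 2 / c) * m → E * N < m := by
    intro m hm
    push_cast at hm
    have h1 : (3 + 2 / c) * ((E + 1) * N) ≤ (3 + 2 / c) * m := by nlinarith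
    have h2 := le_of_mul_le_mul_left h1 hC
    have h3 : ((E * N : ℕ) : ℝ) < m := by push_cast; linarith
    exact_mod_cast h3
  have hA := h.scale_lt_left hs hs' hnest
  have hB := h.scale_lt_right hs hs' hnest
  have hvisit : ∀ x, ∃ τ : ℕ, 1 ≤ τ ∧ τ ≤ E * N ∧ ∃ k : ℤ, F^[τ] x + k ∈ Set.Ioo A B ∧
      g (F^[τ] x) ≤ K * r ^ (ℓ - 1) := by
    rcases min_choice (a - A) (B - b) with h1 | h1
    · rw [hr, h1]; exact h.exists_visit_left hs hE
    · rw [hr, h1]; exact h.exists_visit_right hs hE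
  have hle : ∀ m : ℕ, m ≤ D * N → Real.exp (μ * m - (ℓ - 1) * Real.log (1 / r)) ≤
      Real.exp ((μ - (ℓ - 1) * Real.log (1 / r) / (D * N)) * m) := by
    intro m hm
    have hm' : (m : ℝ) ≤ D * N := by exact_mod_cast hm
    rw [Real.exp_le_exp, sub_mul μ, div_mul_eq_mul_div]
    have : 0 ≤ (ℓ - 1) * Real.log (1 / r) := mul_nonneg (by linarith [h.hℓ]) hlr
    have : (ℓ - 1) * Real.log (1 / r) * m / (D * N) ≤ (ℓ - 1) * Real.log (1 / r) := by
      rw [div_le_iff₀ (by positivity)]; gcongr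
    linarith
  refine ⟨p', q', kp', kq', A', B', hs', fun x hx => ?_, fun x hx => ?_⟩
  · exact (h.orbitProd_left_le_of_visit hs hs' hA hB (hlarge q' (h.le_mul_q hs')) hr0 hvisit
      hq hp hx).trans (hle q' hs'.q_le)
  · have hvisit' : ∀ x, ∃ τ : ℕ, 1 ≤ τ ∧ τ ≤ E * N ∧ ∃ k : ℤ,
        (fun x => -F (-x))^[τ] x + k ∈ Set.Ioo (-B) (-A) ∧
        g (-(fun x => -F (-x))^[τ] x) ≤ K * r ^ (ℓ - 1) := by
      intro x
      obtain ⟨τ, h1, h2, k, h3, h4⟩ := hvisit (-x)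
      refine ⟨τ, h1, h2, -k, ?_, ?_⟩
      · rw [reflect_iterate]; push_cast
        exact ⟨by linarith [h3.2], by linarith [h3.1]⟩
      · rwa [reflect_iterate, neg_neg]
    have := h.reflect.orbitProd_left_le_of_visit (h.isScale_reflect hs) (h.isScale_reflect hs')
      (neg_lt_neg hB) (neg_lt_neg hA) (hlarge p' (h.le_mul_p hs')) hr0 hvisit' (μ := μ)
      (fun y hy => by
        rw [reflect_orbitProd, neg_neg]
        exact hp (-y) ⟨by linarith [hy.2], by linarith [hy.1]⟩)
      (fun y hy => by
        rw [reflect_orbitProd, neg_neg]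
        exact hq (-y) ⟨by linarith [hy.2], by linarith [hy.1]⟩)
      (x := -x) ⟨neg_le_neg hx.2, neg_le_neg hx.1⟩
    rw [reflect_orbitProd, neg_neg, neg_neg] at this
    exact this.trans (hle p' hs'.p_le)

theorem rate_of_scale (h : FlatMapData F g H a b R ℓ K c) {N p q : ℕ} {kp kq : ℤ}
    {A B : ℝ} (hs : IsScale F a b N p q kp kq A B) {r : ℝ} (hr : r = min (a - A) (B - b)) :
    let μ := (2 * Real.log K + ℓ + 2 * K) * (3 + 2 / c) / c * (Real.log (1 / r) + 1) / N
    (∀ x ∈ Set.Icc A b, K * orbitProd F g (q - 1) (F x) ≤ Real.exp (μ * q)) ∧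
    ∀ x ∈ Set.Icc a B, K * orbitProd F g (p - 1) (F x) ≤ Real.exp (μ * p) := by
  intro μ
  have hc := h.hc
  have hK := h.hK
  have hℓ := h.hℓ
  have hAa := hs.A_lt
  have hbB := hs.lt_B
  have hr0 : 0 < r := by rw [hr]; exact lt_min (by linarith) (by linarith)
  have hr1 : r ≤ 1 := by
    rw [hr]; exact (min_le_left _ _).trans (by linarith [(h.scale_bounds hs).2.1])
  have hlr : 0 ≤ Real.log (1 / r) := Real.log_nonneg (by rw [le_div_iff₀ hr0]; linarith)
  have hlK : 0 ≤ Real.log K := Real.log_nonneg hK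
  have hN0 : (0 : ℝ) < N := by exact_mod_cast hs.one_le_p.trans hs.p_le
  have hle : ∀ m : ℕ, c * N ≤ (3 + 2 / c) * m →
      (2 * Real.log K + ℓ + 2 * K) * (Real.log (1 / r) + 1) ≤ μ * m := by
    intro m hm
    have e : μ * m = (2 * Real.log K + ℓ + 2 * K) * (Real.log (1 / r) + 1) *
        ((3 + 2 / c) * m / (c * N)) := by
      simp only [μ]; field_simp
    rw [e]
    refine le_mul_of_one_le_right (by positivity) ?_
    rwa [le_div_iff₀ (by positivity), one_mul]
  exact ⟨fun x hx => (h.orbitProd_left_le hs hr0 (hr.trans_le (min_le_left _ _))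
      (hr.trans_le (min_le_right _ _)) hx).trans (Real.exp_le_exp.2 (hle q (h.le_mul_q hs))),
    fun x hx => (h.orbitProd_right_le hs hr0 (hr.trans_le (min_le_left _ _))
      (hr.trans_le (min_le_right _ _)) hx).trans (Real.exp_le_exp.2 (hle p (h.le_mul_p hs)))⟩

theorem exists_scaleBound (h : FlatMapData F g H a b R ℓ K c) :
    ∃ D : ℕ, 2 ≤ D ∧ ∃ Q > 0, ∃ θ ∈ Set.Ioo (0 : ℝ) 1, 1 < D * θ ∧
      ∀ j : ℕ, ScaleBound F g a b K (D ^ j) (Q * θ ^ j) := by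
  have hc := h.hc
  have hK := h.hK
  have hℓ := h.hℓ
  have hlK : 0 ≤ Real.log K := Real.log_nonneg hK
  obtain ⟨E, hE⟩ := exists_nat_ge ((3 + 2 / c) / c)
  obtain ⟨D, hD⟩ := exists_nat_ge (max 2 ((3 + 2 / c) * (E + 1) / c))
  have hD2 : 2 ≤ D := by exact_mod_cast (le_max_left _ _).trans hD
  have hE' : 3 + 2 / c ≤ c * E := by rwa [div_le_iff₀' hc] at hE
  have hD' : (3 + 2 / c) * (E + 1) ≤ c * D := by
    have := (le_max_right _ _).trans hD
    rwa [div_le_iff₀' hc] at this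
  obtain ⟨p, q, kp, kq, A, B, hs⟩ := h.exists_isScale le_rfl
  have h0 : ScaleBound F g a b K 1 _ := ⟨p, q, kp, kq, A, B, hs, h.rate_of_scale hs rfl⟩
  refine ⟨D, hD2, exists_geometric_bound (Λ := ScaleBound F g a b K)
    (fun N μ ν hμ => ScaleBound.mono hμ) hD2
    (γ := ℓ - 1) (κ := (2 * Real.log K + ℓ + 2 * K) * (3 + 2 / c) / c) (by linarith)
    (by positivity) h0 ?_⟩
  rintro N μ hN ⟨p, q, kp, kq, A, B, hs, hq, hp⟩
  have hAa := hs.A_lt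
  have hbB := hs.lt_B
  have hr0 : 0 < min (a - A) (B - b) := lt_min (by linarith) (by linarith)
  have hr1 : min (a - A) (B - b) ≤ 1 :=
    (min_le_left _ _).trans (by linarith [(h.scale_bounds hs).2.1])
  have hlr : 0 ≤ Real.log (1 / min (a - A) (B - b)) :=
    Real.log_nonneg (by rw [le_div_iff₀ hr0]; linarith)
  have hrate := h.rate_of_scale hs rfl
  refine ⟨_, hlr, h.scaleBound_refine hs hE' hD' rfl hq hp,
    (h.scaleBound_refine hs hE' hD' rfl hrate.1 hrate.2).mono ?_⟩
  refine sub_le_self _ (div_nonneg (mul_nonneg (by linarith) hlr) (by positivity))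

theorem iterate_surjective (h : FlatMapData F g H a b R ℓ K c) (n : ℕ) :
    Function.Surjective F^[n] := by
  intro y
  set m : ℤ := ⌊y - F^[n] 0⌋ with hm
  have h1 : F^[n] m = F^[n] 0 + m := by simpa using h.iterate_add_int n 0 m
  have h2 : F^[n] (m + 1) = F^[n] 0 + m + 1 := by
    have := h.iterate_add_int n 0 (m + 1)
    push_cast at this
    rw [zero_add] at this
    rw [this]; ring
  have h3 := Int.floor_le (y - F^[n] 0)
  have h4 := Int.lt_floor_add_one (y - F^[n] 0)
  obtain ⟨x, -, hx⟩ := intermediate_value_Icc (by linarith : (m : ℝ) ≤ m + 1)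
    (h.continuous_iterate n).continuousOn (show y ∈ Set.Icc (F^[n] m) (F^[n] (m + 1)) by
      rw [h1, h2]; constructor <;> linarith)
  exact ⟨x, hx⟩

/-- The image of the right part of a scale is not too short: some iterate maps a piece of it
onto the flat interval. -/
theorem le_sub_image_right (h : FlatMapData F g H a b R ℓ K c) {N p q E : ℕ} {kp kq : ℤ}
    {A B : ℝ} (hs : IsScale F a b N p q kp kq A B) (hE : 3 + 2 / c ≤ c * E) {μ : ℝ} (hμ : 0 ≤ μ)
    (hq : ∀ x ∈ Set.Icc A b, K * orbitProd F g (q - 1) (F x) ≤ Real.exp (μ * q))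
    (hp : ∀ x ∈ Set.Icc a B, K * orbitProd F g (p - 1) (F x) ≤ Real.exp (μ * p)) :
    b - a ≤ Real.exp (μ * (E * N)) * (F B - F b) := by
  have hc := h.hc
  have hK := h.hK
  have hab := h.hab
  have hAa := hs.A_lt
  have hbB := hs.lt_B
  have hHb := h.H_b
  have hN : 1 ≤ N := hs.one_le_p.trans hs.p_le
  have hN0 : (0 : ℝ) < N := by exact_mod_cast hN
  have hE0 : 0 < E := by
    rcases Nat.eq_zero_or_pos E with rfl | hpos
    · have : 0 < 2 / c := by positivity
      push_cast at hE; linarith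
    · exact hpos
  have hEr : (0 : ℝ) < E := by exact_mod_cast hE0
  have hqN : (q : ℝ) ≤ N := by exact_mod_cast hs.q_le
  have h1 : c ≤ N * (H B - H b) := (h.le_mul_H_right hs).trans
    (mul_le_mul_of_nonneg_right hqN (by linarith [h.H_mono hs.lt_B.le]))
  obtain ⟨i, hi, hiE, k, hk⟩ := exists_nat_mul_add_int_mem_Ioo h.hc h.badly
    (Nat.mul_pos hE0 hN) (x := H b - H B) (y := 0) (by
      push_cast
      rw [div_le_iff₀ (by positivity)]
      nlinarith)
  obtain ⟨x₁, hx₁⟩ := h.iterate_surjective i (a - k)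
  obtain ⟨x₂, hx₂⟩ := h.iterate_surjective i (b - k)
  have hHx : ∀ {x y : ℝ}, F^[i] x = y - k → H x = H y - (i * R + k) := by
    intro x y hxy
    have e1 := h.H_iterate i x
    have e2 := h.H_add_int (F^[i] x) k
    rw [show F^[i] x + k = y by linarith] at e2
    linarith
  have hH1 := hHx hx₁
  have hH2 := hHx hx₂
  have hbx : b < x₁ := h.lt_of_H_lt (by linarith [hk.2])
  have hxB : x₂ < B := h.lt_of_H_lt (by linarith [hk.1])
  obtain ⟨m, rfl⟩ := Nat.exists_eq_add_of_le' hi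
  rw [Function.iterate_succ_apply] at hx₁ hx₂
  have hFlt : F x₁ < F x₂ := by
    by_contra! hle
    have := h.iterate_mono m hle
    linarith
  have hxlt : x₁ < x₂ := by
    by_contra! hle
    exact hFlt.not_ge (h.mono hle)
  obtain ⟨w, hw, hweq⟩ := exists_hasDerivAt_eq_slope (F^[m]) (orbitProd F g m) hFlt
    (h.continuous_iterate _).continuousOn fun x _ => h.hasDerivAt_iterate _ x
  obtain ⟨x, hx, rfl⟩ := intermediate_value_Icc hxlt.le
    (continuous_iff_continuousAt.2 fun x => (h.hasDerivAt x).continuousAt).continuousOn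
    ⟨hw.1.le, hw.2.le⟩
  have hret := h.orbitProd_le_of_returns hs hq hp (m + 1) x
    ⟨by linarith [hx.1], by linarith [hx.2]⟩ hi k (by
      rw [Function.iterate_succ_apply]
      have e1 := h.iterate_mono m hw.1.le
      have e2 := h.iterate_mono m hw.2.le
      constructor <;> linarith)
  rw [Nat.add_sub_cancel] at hret
  have hle : Real.exp (μ * ((m + 1 : ℕ) : ℝ)) ≤ Real.exp (μ * (E * N)) := by
    have : ((m + 1 : ℕ) : ℝ) ≤ E * N := by exact_mod_cast hiE
    gcongr
  have hP := h.orbitProd_nonneg m (F x)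
  have hP2 : orbitProd F g m (F x) ≤ Real.exp (μ * (E * N)) :=
    (le_mul_of_one_le_left hP hK).trans (hret.trans hle)
  rw [eq_div_iff (by linarith), hx₁, hx₂] at hweq
  have e1 : b - a = orbitProd F g m (F x) * (F x₂ - F x₁) := by linarith
  rw [e1]
  have e2 : F x₂ - F x₁ ≤ F B - F b := by linarith [h.mono hxB.le, h.mono hbx.le]
  gcongr

theorem le_sub_image_left (h : FlatMapData F g H a b R ℓ K c) {N p q E : ℕ} {kp kq : ℤ}
    {A B : ℝ} (hs : IsScale F a b N p q kp kq A B) (hE : 3 + 2 / c ≤ c * E) {μ : ℝ} (hμ : 0 ≤ μ)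
    (hq : ∀ x ∈ Set.Icc A b, K * orbitProd F g (q - 1) (F x) ≤ Real.exp (μ * q))
    (hp : ∀ x ∈ Set.Icc a B, K * orbitProd F g (p - 1) (F x) ≤ Real.exp (μ * p)) :
    b - a ≤ Real.exp (μ * (E * N)) * (F a - F A) := by
  have := h.reflect.le_sub_image_right (h.isScale_reflect hs) hE hμ
    (fun y hy => by
      rw [reflect_orbitProd, neg_neg]
      exact hp (-y) ⟨by linarith [hy.2], by linarith [hy.1]⟩)
    (fun y hy => by
      rw [reflect_orbitProd, neg_neg]
      exact hq (-y) ⟨by linarith [hy.2], by linarith [hy.1]⟩)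
  simp only [neg_neg] at this
  rwa [show -a - -b = b - a by ring, show -F A - -F a = F a - F A by ring] at this

/-- Returns of the critical value are at least stretched-exponentially far from it. -/
theorem exists_neg_log_return_le (h : FlatMapData F g H a b R ℓ K c) :
    ∃ Q > 0, ∃ s ∈ Set.Ioo (0 : ℝ) 1, ∀ n : ℕ, 1 ≤ n → ∀ k : ℤ,
      -Real.log |F^[n] (F a) + k - F a| ≤ Q * (n : ℝ) ^ s := by
  obtain ⟨D, hD, Q, hQ, θ, hθ, hDθ, hb⟩ := h.exists_scaleBound
  have hc := h.hc
  have hab := h.hab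
  obtain ⟨E, hE⟩ := exists_nat_ge ((3 + 2 / c) / c)
  rw [div_le_iff₀' hc] at hE
  have hDr : (2 : ℝ) ≤ D := by exact_mod_cast hD
  set s : ℝ := Real.logb D (D * θ) with hs
  have hpow : (D : ℝ) ^ s = D * θ := Real.rpow_logb (by linarith) (by linarith) (by linarith)
  have hs0 : 0 < s := Real.logb_pos (by linarith) hDθ
  have hs1 : s < 1 := by
    rw [hs, Real.logb_lt_iff_lt_rpow (by linarith) (by linarith), Real.rpow_one]
    nlinarith [hθ.2]
  set P : ℝ := |Real.log (b - a)| + Q * E with hP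
  refine ⟨(P + 1) * (D : ℝ) ^ s, by positivity, s, ⟨hs0, hs1⟩, fun n hn k => ?_⟩
  set j := Nat.clog D n with hj
  have hnj : n ≤ D ^ j := Nat.le_pow_clog (by omega) n
  have hjn : D ^ j ≤ D * n := by
    rcases hn.eq_or_lt with rfl | hlt
    · rw [hj, Nat.clog_one_right, pow_zero]; omega
    · have h1 := Nat.pow_pred_clog_lt_self (b := D) (by omega) hlt
      have h2 : 0 < Nat.clog D n := Nat.clog_pos (by omega) (by omega)
      rw [hj, ← Nat.succ_pred_eq_of_pos h2, pow_succ, mul_comm]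
      exact Nat.mul_le_mul_left _ h1.le
  obtain ⟨p, q, kp, kq, A, B, hsc, hq, hp⟩ := hb j
  have hμ : 0 ≤ Q * θ ^ j := by have := hθ.1; positivity
  have hR := h.le_sub_image_right hsc hE hμ hq hp
  have hL := h.le_sub_image_left hsc hE hμ hq hp
  push_cast at hR hL
  set T : ℝ := Q * θ ^ j * (E * (D : ℝ) ^ j) with hT
  have hT' : T = Q * E * (D * θ) ^ j := by rw [hT, mul_pow]; ring
  have hFy : F^[n] (F a) + k = F (F^[n] a + k) := by
    rw [h.F_add_int, ← Function.iterate_succ_apply, Function.iterate_succ_apply']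
  have hmain : b - a ≤ Real.exp T * |F^[n] (F a) + k - F a| := by
    rw [hFy]
    rcases hsc.gap n hn hnj k with h1 | h1
    · refine hL.trans ?_
      have := h.mono h1
      gcongr
      rw [abs_sub_comm]
      exact le_trans (by linarith) (le_abs_self _)
    · refine hR.trans ?_
      have := h.mono h1
      have := h.flat
      gcongr
      exact le_trans (by linarith) (le_abs_self _)
  have hpos : 0 < |F^[n] (F a) + k - F a| := by
    rcases (abs_nonneg (F^[n] (F a) + k - F a)).eq_or_lt with h0 | h0
    · rw [← h0] at hmain; linarith
    · exact h0
  have hlog := Real.log_le_log (by linarith) hmain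
  rw [Real.log_mul (Real.exp_pos _).ne' hpos.ne', Real.log_exp] at hlog
  have hone : 1 ≤ (D * θ) ^ j := one_le_pow₀ hDθ.le
  have h3 : -Real.log |F^[n] (F a) + k - F a| ≤ P * (D * θ) ^ j := by
    have := neg_abs_le (Real.log (b - a))
    have := le_mul_of_one_le_right (abs_nonneg (Real.log (b - a))) hone
    rw [hP, add_mul]
    linarith
  have h4 : ((D : ℝ) * θ) ^ j ≤ (D : ℝ) ^ s * (n : ℝ) ^ s := by
    rw [← hpow, ← Real.rpow_natCast, ← Real.rpow_mul (by positivity), mul_comm s,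
      Real.rpow_mul (by positivity), Real.rpow_natCast, ← Real.mul_rpow (by positivity)
      (by positivity)]
    have : (D : ℝ) ^ j ≤ D * n := by exact_mod_cast hjn
    gcongr
  calc _ ≤ P * (D * θ) ^ j := h3
    _ ≤ (P + 1) * ((D : ℝ) ^ s * (n : ℝ) ^ s) := by
      gcongr
      linarith
    _ = _ := by ring

end FlatMapData

/-- One-sided estimates for a function which behaves like `t ↦ t ^ ℓ` in a smooth coordinate. -/
theorem exists_powerLaw_estimates {F ψ : ℝ → ℝ} {b ε ℓ : ℝ} (hℓ : 1 < ℓ) (hε : 0 < ε)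
    (hψ : ContDiff ℝ (⊤ : ℕ∞) ψ) (hψ0 : ψ 0 = 0) (hψ' : 0 < deriv ψ 0)
    (hloc : ∀ t ∈ Set.Ico (0 : ℝ) ε, F (b + t) = F b + ψ (t ^ ℓ)) :
    HasDerivWithinAt F 0 (Set.Ici b) b ∧ ∃ δ > 0, ∃ M > 0, ∀ t ∈ Set.Ioo 0 δ,
      deriv F (b + t) ≤ M * t ^ (ℓ - 1) ∧ t ^ ℓ ≤ M * (F (b + t) - F b) ∧
      |deriv (fun x => Real.log (deriv F x)) (b + t)| ≤ M / t := by
  have hdiff : Differentiable ℝ ψ := hψ.differentiable (by simp)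
  have hdd : ContDiff ℝ (⊤ : ℕ∞) (deriv ψ) := (contDiff_infty_iff_deriv.1 hψ).2
  have hdiff' : Differentiable ℝ (deriv ψ) := hdd.differentiable (by simp)
  have hddd : Continuous (deriv (deriv ψ)) := (contDiff_infty_iff_deriv.1 hdd).2.continuous
  have hpow : ∀ y : ℝ, HasDerivAt (fun x => F b + ψ ((x - b) ^ ℓ))
      (deriv ψ ((y - b) ^ ℓ) * (ℓ * (y - b) ^ (ℓ - 1))) y := by
    intro y
    have h1 : HasDerivAt (fun x : ℝ => (x - b) ^ ℓ) (ℓ * (y - b) ^ (ℓ - 1)) y := by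
      have := (Real.hasDerivAt_rpow_const (x := y - b) (p := ℓ) (Or.inr hℓ.le)).comp y
        ((hasDerivAt_id y).sub_const b)
      exact this.congr_deriv (mul_one _)
    exact ((hdiff _).hasDerivAt.comp y h1).const_add _
  constructor
  · have h1 := (hpow b).hasDerivWithinAt (s := Set.Ici b)
    rw [sub_self, Real.zero_rpow (by linarith : ℓ - 1 ≠ 0), mul_zero, mul_zero] at h1
    refine h1.congr_of_eventuallyEq ?_ ?_
    · have : Set.Ico b (b + ε) ∈ nhdsWithin b (Set.Ici b) := Ico_mem_nhdsGE (by linarith)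
      filter_upwards [this] with x hx
      have := hloc (x - b) ⟨by linarith [hx.1], by linarith [hx.2]⟩
      rwa [add_sub_cancel] at this
    · rw [sub_self, Real.zero_rpow (by linarith), hψ0, add_zero]
  set m := deriv ψ 0 with hm
  set L := |deriv (deriv ψ) 0| + 1 with hL
  have ev1 : ∀ᶠ s in nhds (0 : ℝ), m / 2 < deriv ψ s :=
    hdd.continuous.continuousAt.eventually_const_lt (by linarith)
  have ev2 : ∀ᶠ s in nhds (0 : ℝ), deriv ψ s < 2 * m :=
    hdd.continuous.continuousAt.eventually_lt_const (by linarith)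
  have ev3 : ∀ᶠ s in nhds (0 : ℝ), |deriv (deriv ψ) s| < L :=
    hddd.abs.continuousAt.eventually_lt_const (by linarith)
  obtain ⟨ρ, hρ, hρb⟩ := Metric.eventually_nhds_iff.1 (ev1.and (ev2.and ev3))
  have hb : ∀ s, 0 ≤ s → s < ρ → m / 2 < deriv ψ s ∧ deriv ψ s < 2 * m ∧
      |deriv (deriv ψ) s| < L := fun s hs hsρ =>
    hρb (by rwa [Real.dist_eq, sub_zero, abs_of_nonneg hs])
  set δ := min 1 (min ε ρ) with hδ
  have hδ0 : 0 < δ := lt_min one_pos (lt_min hε hρ)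
  have hδ1 : δ ≤ 1 := min_le_left _ _
  have hδε : δ ≤ ε := (min_le_right _ _).trans (min_le_left _ _)
  have hδρ : δ ≤ ρ := (min_le_right _ _).trans (min_le_right _ _)
  have hL0 : 0 < L := by positivity
  refine ⟨δ, hδ0, 2 * m * ℓ + 2 / m + (2 * L * ℓ / m + ℓ), by positivity, fun t ht => ?_⟩
  have ht0 := ht.1
  have ht1 : t ≤ 1 := ht.2.le.trans hδ1
  have hs0 : 0 ≤ t ^ ℓ := by positivity
  have hsρ : t ^ ℓ < ρ := by
    have : t ^ ℓ ≤ t := by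
      simpa using Real.rpow_le_rpow_of_exponent_ge ht0 ht1 hℓ.le
    linarith [ht.2]
  obtain ⟨b1, b2, b3⟩ := hb _ hs0 hsρ
  have hpw1 : t ^ (ℓ - 1) ≤ 1 := Real.rpow_le_one ht0.le ht1 (by linarith)
  have hpw0 : 0 < t ^ (ℓ - 1) := by positivity
  have hFeq : ∀ y ∈ Set.Ioo b (b + δ), F =ᶠ[nhds y] fun x => F b + ψ ((x - b) ^ ℓ) := by
    intro y hy
    filter_upwards [isOpen_Ioo.mem_nhds hy] with x hx
    have := hloc (x - b) ⟨by linarith [hx.1], by linarith [hx.2]⟩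
    rwa [add_sub_cancel] at this
  have hderiv : ∀ y ∈ Set.Ioo b (b + δ),
      deriv F y = deriv ψ ((y - b) ^ ℓ) * (ℓ * (y - b) ^ (ℓ - 1)) := fun y hy =>
    ((hpow y).congr_of_eventuallyEq (hFeq y hy)).deriv
  have hbt : b + t ∈ Set.Ioo b (b + δ) := ⟨by linarith, by linarith [ht.2]⟩
  refine ⟨?_, ?_, ?_⟩
  · rw [hderiv _ hbt, add_sub_cancel_left]
    calc deriv ψ (t ^ ℓ) * (ℓ * t ^ (ℓ - 1)) ≤ 2 * m * (ℓ * t ^ (ℓ - 1)) := by gcongr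
      _ = 2 * m * ℓ * t ^ (ℓ - 1) := by ring
      _ ≤ _ := by
        gcongr
        have : 0 < 2 / m + (2 * L * ℓ / m + ℓ) := by positivity
        linarith
  · have hmv : m / 2 * (t ^ ℓ - 0) ≤ ψ (t ^ ℓ) - ψ 0 := by
      refine (convex_Icc 0 (t ^ ℓ)).mul_sub_le_image_sub_of_le_deriv
        hdiff.continuous.continuousOn hdiff.differentiableOn (fun x hx => ?_)
        0 ⟨le_rfl, hs0⟩ _ ⟨hs0, le_rfl⟩ hs0
      rw [interior_Icc] at hx
      exact (hb x hx.1.le (hx.2.trans hsρ)).1.le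
    rw [hψ0, sub_zero, sub_zero] at hmv
    rw [hloc t ⟨ht0.le, by linarith [ht.2]⟩, add_sub_cancel_left]
    have hψpos : 0 ≤ ψ (t ^ ℓ) := le_trans (by positivity) hmv
    calc t ^ ℓ = 2 / m * (m / 2 * t ^ ℓ) := by field_simp
      _ ≤ 2 / m * ψ (t ^ ℓ) := by gcongr
      _ ≤ _ := by
        gcongr
        have : 0 < 2 * m * ℓ + (2 * L * ℓ / m + ℓ) := by positivity
        linarith
  · have hlog : (fun x => Real.log (deriv F x)) =ᶠ[nhds (b + t)] fun x =>
        Real.log (deriv ψ ((x - b) ^ ℓ)) + (Real.log ℓ + (ℓ - 1) * Real.log (x - b)) := by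
      filter_upwards [isOpen_Ioo.mem_nhds hbt] with x hx
      have hx0 : 0 < x - b := by linarith [hx.1]
      have hx1 : (x - b) ^ ℓ ≤ x - b := by
        simpa using Real.rpow_le_rpow_of_exponent_ge hx0 (by linarith [hx.2]) hℓ.le
      have := (hb ((x - b) ^ ℓ) (by positivity) (by linarith [hx.2])).1
      rw [hderiv x hx, Real.log_mul (by linarith) (by positivity),
        Real.log_mul (by linarith) (by positivity), Real.log_rpow hx0]
    have hD : HasDerivAt (fun x => Real.log (deriv ψ ((x - b) ^ ℓ)) +
        (Real.log ℓ + (ℓ - 1) * Real.log (x - b)))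
        (deriv (deriv ψ) (t ^ ℓ) * (ℓ * t ^ (ℓ - 1)) / deriv ψ (t ^ ℓ) + (ℓ - 1) * (1 / t))
        (b + t) := by
      have h0 : HasDerivAt (fun x : ℝ => x - b) 1 (b + t) := (hasDerivAt_id _).sub_const b
      have h1 : HasDerivAt (fun x : ℝ => (x - b) ^ ℓ) (ℓ * t ^ (ℓ - 1)) (b + t) := by
        have := (Real.hasDerivAt_rpow_const (x := b + t - b) (p := ℓ) (Or.inr hℓ.le)).comp
          (b + t) h0
        exact this.congr_deriv (by simp)
      have h2 : HasDerivAt (fun x : ℝ => deriv ψ ((x - b) ^ ℓ))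
          (deriv (deriv ψ) (t ^ ℓ) * (ℓ * t ^ (ℓ - 1))) (b + t) := by
        have := (hdiff' ((b + t - b) ^ ℓ)).hasDerivAt.comp (b + t) h1
        exact this.congr_deriv (by simp)
      have h3 := h2.log (by rw [add_sub_cancel_left]; linarith)
      rw [add_sub_cancel_left] at h3
      have h4 := h0.log (by rw [add_sub_cancel_left]; linarith)
      rw [add_sub_cancel_left] at h4
      exact h3.add ((h4.const_mul _).const_add _)
    rw [hlog.deriv_eq, hD.deriv]
    have e1 : |deriv (deriv ψ) (t ^ ℓ) * (ℓ * t ^ (ℓ - 1)) / deriv ψ (t ^ ℓ)| ≤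
        2 * L * ℓ / m := by
      rw [abs_div, abs_mul, abs_of_pos (by linarith : 0 < deriv ψ (t ^ ℓ)),
        abs_of_pos (by positivity : 0 < ℓ * t ^ (ℓ - 1)), div_le_div_iff₀ (by linarith) hψ']
      calc |deriv (deriv ψ) (t ^ ℓ)| * (ℓ * t ^ (ℓ - 1)) * m ≤ L * (ℓ * 1) * m := by gcongr
        _ = 2 * L * ℓ * (m / 2) := by ring
        _ ≤ 2 * L * ℓ * deriv ψ (t ^ ℓ) := by gcongr
    have e2 : |(ℓ - 1) * (1 / t)| ≤ ℓ / t := by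
      rw [abs_of_pos (mul_pos (by linarith) (by positivity)), mul_one_div]
      gcongr; linarith
    have e3 : 2 * L * ℓ / m ≤ 2 * L * ℓ / m / t := by
      rw [le_div_iff₀ ht0]
      exact mul_le_of_le_one_right (by positivity) ht1
    calc _ ≤ 2 * L * ℓ / m / t + ℓ / t := (abs_add_le _ _).trans (by linarith)
      _ = (2 * L * ℓ / m + ℓ) / t := by ring
      _ ≤ _ := by
        have : 0 < 2 * m * ℓ + 2 / m := by positivity
        exact div_le_div_of_nonneg_right (by linarith) ht0.le

/-- A monotone degree one map with translation number `R` is semiconjugate to the translation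
by `R`. -/
theorem exists_semiconj_translation {F : ℝ → ℝ} (hmono : Monotone F)
    (hdeg : ∀ x, F (x + 1) = F x + 1) {R : ℝ}
    (hlim : Tendsto (fun n : ℕ => F^[n] 0 / n) atTop (nhds R)) :
    ∃ H : ℝ → ℝ, Monotone H ∧ (∀ x, H (x + 1) = H x + 1) ∧ ∀ x, H (F x) = H x + R := by
  let f : CircleDeg1Lift := ⟨⟨F, hmono⟩, hdeg⟩
  have hf : ∀ n, ⇑(f ^ n) = F^[n] := fun n => CircleDeg1Lift.coe_pow f n
  have hR : f.translationNumber = R := by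
    refine tendsto_nhds_unique f.tendsto_translation_number₀ (hlim.congr fun n => ?_)
    rw [hf]
  have hFint : ∀ (n : ℕ) (x : ℝ) (k : ℤ), F^[n] (x + k) = F^[n] x + k := by
    intro n x k
    rw [← hf, CircleDeg1Lift.map_add_int]
  have h0 : ∀ n : ℕ, |F^[n] 0 - n * R| ≤ 1 := by
    intro n
    have := f.dist_pow_map_zero_mul_translationNumber_le n
    rwa [hf, hR, Real.dist_eq] at this
  set u : ℝ → ℕ → ℝ := fun x n => F^[n] x - n * R with hu
  have hup : ∀ x n, u x n ≤ ⌈x⌉ + 1 := by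
    intro x n
    have h1 := hmono.iterate n (Int.le_ceil x)
    have h2 := hFint n 0 ⌈x⌉
    rw [zero_add] at h2
    have := (abs_le.1 (h0 n)).2
    simp only [hu]; linarith
  have hlo : ∀ x n, ⌊x⌋ - 1 ≤ u x n := by
    intro x n
    have h1 := hmono.iterate n (Int.floor_le x)
    have h2 := hFint n 0 ⌊x⌋
    rw [zero_add] at h2
    have := (abs_le.1 (h0 n)).1
    simp only [hu]; linarith
  have hbdd : ∀ x, IsBoundedUnder (· ≤ ·) atTop (u x) := fun x =>
    isBoundedUnder_of ⟨_, hup x⟩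
  have hcob : ∀ x, IsCoboundedUnder (· ≤ ·) atTop (u x) := fun x =>
    IsBoundedUnder.isCoboundedUnder_le (isBoundedUnder_of ⟨_, hlo x⟩)
  refine ⟨fun x => limsup (u x) atTop, fun x y hxy => ?_, fun x => ?_, fun x => ?_⟩
  · refine limsup_le_limsup (Eventually.of_forall fun n => ?_) (hcob x) (hbdd y)
    exact sub_le_sub_right (hmono.iterate n hxy) _
  · have : u (x + 1) = fun n => u x n + 1 := by
      funext n
      have := hFint n x 1
      push_cast at this
      simp only [hu, this]; ring
    simp only [this]
    exact limsup_add_const _ _ _ (hbdd x) (hcob x)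
  · have : u (F x) = fun n => u x (n + 1) + R := by
      funext n
      simp only [hu, Function.iterate_succ_apply]; push_cast; ring
    simp only [this]
    rw [limsup_add_const atTop (fun n => u x (n + 1)) R
      (isBoundedUnder_of ⟨_, fun n => hup x (n + 1)⟩)
      (IsBoundedUnder.isCoboundedUnder_le (isBoundedUnder_of ⟨_, fun n => hlo x (n + 1)⟩)),
      limsup_nat_add (u x) 1]

/-- Integrating a bound on the derivative with simple poles at the endpoints. -/
theorem abs_sub_le_of_abs_deriv_le {w : ℝ → ℝ} {b e K : ℝ}
    (hw : ∀ x ∈ Set.Ioo b e, DifferentiableAt ℝ w x)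
    (hd : ∀ x ∈ Set.Ioo b e, |deriv w x| ≤ K * (1 / (x - b) + 1 / (e - x))) (u v : ℝ)
    (hu : b < u) (huv : u ≤ v) (hv : v < e) : |w v - w u| ≤
      K * (Real.log (v - b) - Real.log (u - b) + (Real.log (e - u) - Real.log (e - v))) := by
  set G : ℝ → ℝ := fun x => K * (Real.log (x - b) - Real.log (e - x)) with hG
  have hGd : ∀ x ∈ Set.Ioo b e, HasDerivAt G (K * (1 / (x - b) + 1 / (e - x))) x := by
    intro x hx
    have h1 := ((hasDerivAt_id x).sub_const b).log (by simp only [id]; linarith [hx.1])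
    have h2 := ((hasDerivAt_id x).const_sub e).log (by simp only [id]; linarith [hx.2])
    refine ((h1.sub h2).const_mul K).congr_deriv ?_
    simp only [id]; ring
  have key : ∀ s : ℝ, |s| ≤ 1 → MonotoneOn (fun x => G x + s * w x) (Set.Ioo b e) := by
    intro s hs
    have hder : ∀ x ∈ Set.Ioo b e, HasDerivAt (fun x => G x + s * w x)
        (K * (1 / (x - b) + 1 / (e - x)) + s * deriv w x) x := fun x hx =>
      (hGd x hx).add ((hw x hx).hasDerivAt.const_mul s)
    refine monotoneOn_of_deriv_nonneg (convex_Ioo b e)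
      (fun x hx => (hder x hx).continuousAt.continuousWithinAt)
      (fun x hx => ?_) (fun x hx => ?_)
    · rw [interior_Ioo] at hx
      exact (hder x hx).differentiableAt.differentiableWithinAt
    · rw [interior_Ioo] at hx
      rw [(hder x hx).deriv]
      have h1 : |s * deriv w x| ≤ K * (1 / (x - b) + 1 / (e - x)) := by
        rw [abs_mul]
        exact (mul_le_of_le_one_left (abs_nonneg _) hs).trans (hd x hx)
      linarith [neg_le_of_abs_le h1]
  have hum : u ∈ Set.Ioo b e := ⟨hu, huv.trans_lt hv⟩
  have hvm : v ∈ Set.Ioo b e := ⟨hu.trans_le huv, hv⟩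
  have h1 := key 1 (by simp) hum hvm huv
  have h2 := key (-1) (by simp) hum hvm huv
  simp only [hG] at h1 h2
  rw [abs_le]
  constructor <;> linarith

namespace CherryMap

variable {ℓ : ℝ} (X : CherryMap ℓ)

theorem left_estimates (hℓ : 1 < ℓ) :
    HasDerivWithinAt X.F 0 (Set.Iic X.a) X.a ∧ ∃ δ > 0, ∃ M > 0, ∀ t ∈ Set.Ioo 0 δ,
      deriv X.F (X.a - t) ≤ M * t ^ (ℓ - 1) ∧ t ^ ℓ ≤ M * (X.F X.a - X.F (X.a - t)) ∧
      |deriv (fun x => Real.log (deriv X.F x)) (X.a - t)| ≤ M / t := by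
  obtain ⟨h1, δ, hδ, M, hM, h⟩ := exists_powerLaw_estimates (F := fun x => -X.F (-x))
    (b := -X.a) hℓ X.εpos X.ψa_smooth X.ψa_zero X.ψa_deriv_pos (fun t ht => by
      have := X.local_a t ht
      rw [neg_neg, show -(-X.a + t) = X.a - t by ring, this]; ring)
  have hd : deriv (fun x => -X.F (-x)) = fun x => deriv X.F (-x) := by
    funext x
    rw [deriv.fun_neg, deriv_comp_neg, neg_neg]
  constructor
  · have h2 : HasDerivWithinAt (fun x : ℝ => -x) (-1) (Set.Iic X.a) X.a :=
      (hasDerivAt_neg X.a).hasDerivWithinAt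
    have h3 := (HasDerivWithinAt.comp X.a h1 h2 fun x hx =>
      Set.mem_Ici.2 (neg_le_neg (Set.mem_Iic.1 hx))).neg
    simp only [zero_mul, neg_zero] at h3
    refine h3.congr (fun x _ => ?_) ?_ <;> simp
  · refine ⟨δ, hδ, M, hM, fun t ht => ?_⟩
    obtain ⟨e1, e2, e3⟩ := h t ht
    have hat : -(-X.a + t) = X.a - t := by ring
    rw [hd] at e1 e3
    rw [deriv_comp_neg (fun x => Real.log (deriv X.F x)), abs_neg] at e3
    simp only [hat, neg_neg] at e1 e2 e3
    exact ⟨e1, by linarith, e3⟩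

theorem right_estimates (hℓ : 1 < ℓ) :
    HasDerivWithinAt X.F 0 (Set.Ici X.b) X.b ∧ ∃ δ > 0, ∃ M > 0, ∀ t ∈ Set.Ioo 0 δ,
      deriv X.F (X.b + t) ≤ M * t ^ (ℓ - 1) ∧ t ^ ℓ ≤ M * (X.F (X.b + t) - X.F X.b) ∧
      |deriv (fun x => Real.log (deriv X.F x)) (X.b + t)| ≤ M / t :=
  exists_powerLaw_estimates hℓ X.εpos X.ψb_smooth X.ψb_zero X.ψb_deriv_pos X.local_b

theorem deriv_F_add_one (x : ℝ) : deriv X.F (x + 1) = deriv X.F x := by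
  rw [← deriv_comp_add_const]
  have : (fun x => X.F (x + 1)) = fun x => X.F x + 1 := funext X.degree_one
  rw [this, deriv_add_const]

theorem hasDerivAt_of_mem_Icc (hℓ : 1 < ℓ) {x : ℝ} (hx : x ∈ Set.Icc X.a X.b) :
    HasDerivAt X.F 0 x := by
  have hflat : HasDerivWithinAt X.F 0 (Set.Icc X.a X.b) x :=
    (hasDerivWithinAt_const x _ (X.F X.a)).congr X.flat (X.flat x hx)
  rcases hx.1.eq_or_lt with rfl | h1
  · have h2 := (X.left_estimates hℓ).1.union hflat
    refine h2.hasDerivAt ?_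
    rw [Set.Iic_union_Icc_eq_Iic X.hab.le]
    exact Iic_mem_nhds X.hab
  rcases hx.2.eq_or_lt with rfl | h2
  · have h2 := hflat.union (X.right_estimates hℓ).1
    refine h2.hasDerivAt ?_
    rw [Set.Icc_union_Ici_eq_Ici X.hab.le]
    exact Ici_mem_nhds X.hab
  · exact hflat.hasDerivAt (Icc_mem_nhds h1 h2)

/-- Every point has an integer translate in the fundamental domain `[a, a + 1)`. -/
theorem exists_translate (P : ℝ → Prop) (hP : ∀ x (k : ℤ), P (x + k) → P x)
    (h1 : ∀ x ∈ Set.Icc X.a X.b, P x) (h2 : ∀ x ∈ Set.Ioo X.b (X.a + 1), P x) (x : ℝ) : P x := by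
  apply hP x ⌈X.a - x⌉
  have e1 := Int.le_ceil (X.a - x)
  have e2 := Int.ceil_lt_add_one (X.a - x)
  rcases le_or_gt (x + ⌈X.a - x⌉) X.b with h | h
  · exact h1 _ ⟨by linarith, h⟩
  · exact h2 _ ⟨h, by linarith⟩

theorem F_add_int (x : ℝ) (k : ℤ) : X.F (x + k) = X.F x + k :=
  apply_add_intCast_of_add_one X.degree_one x k

theorem deriv_F_add_int (x : ℝ) (k : ℤ) : deriv X.F (x + k) = deriv X.F x := by
  rw [← deriv_comp_add_const]
  have : (fun x => X.F (x + k)) = fun x => X.F x + k := funext fun x => X.F_add_int x k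
  rw [this, deriv_add_const]

theorem differentiableAt_F (hℓ : 1 < ℓ) (x : ℝ) : DifferentiableAt ℝ X.F x := by
  refine X.exists_translate (fun x => DifferentiableAt ℝ X.F x) (fun x k h => ?_)
    (fun x hx => (X.hasDerivAt_of_mem_Icc hℓ hx).differentiableAt) (fun x hx => ?_) x
  · have e : X.F = fun y => X.F (y + k) - k := funext fun y => by rw [X.F_add_int]; ring
    rw [e]
    exact ((differentiableAt_comp_add_const (f := X.F)).2 h).sub_const _
  · exact (X.smooth.differentiableOn (by simp)).differentiableAt (isOpen_Ioo.mem_nhds hx)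

theorem iterate_coe (n : ℕ) (x : ℝ) :
    X.f^[n] (x : AddCircle (1 : ℝ)) = ((X.F^[n] x : ℝ) : AddCircle (1 : ℝ)) := by
  induction n generalizing x with
  | zero => rfl
  | succ n ih => rw [Function.iterate_succ_apply, X.isLift, ih, Function.iterate_succ_apply]

theorem coe_add_int (x : ℝ) (k : ℤ) :
    ((x + k : ℝ) : AddCircle (1 : ℝ)) = (x : AddCircle (1 : ℝ)) := by
  have : ((k : ℝ) : AddCircle (1 : ℝ)) = 0 := by
    rw [AddCircle.coe_eq_zero_iff]
    exact ⟨k, by simp⟩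
  rw [AddCircle.coe_add, this, add_zero]

theorem iterate_F_ne {n : ℕ} (hn : 1 ≤ n) (k : ℤ) (x : ℝ) : X.F^[n] x ≠ x + k := by
  intro h
  apply X.no_periodic_pt x n hn
  rw [X.iterate_coe, h, coe_add_int]

end CherryMap

theorem abs_bound_on_Icc {w : ℝ → ℝ} {b e u v : ℝ} (hw : ContinuousOn w (Set.Ioo b e))
    (hu : b < u) (hv : v < e) : ∃ W ≥ 0, ∀ x ∈ Set.Icc u v, |w x| ≤ W := by
  obtain ⟨W, hW⟩ := isCompact_Icc.exists_bound_of_continuousOn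
    (hw.mono (Set.Icc_subset_Ioo hu hv))
  exact ⟨|W|, abs_nonneg _, fun x hx => (hW x hx).trans (le_abs_self W)⟩

namespace CherryMap

variable {ℓ : ℝ} (X : CherryMap ℓ)

theorem contDiffOn_deriv_F : ContDiffOn ℝ (⊤ : ℕ∞) (deriv X.F) (Set.Ioo X.b (X.a + 1)) :=
  X.smooth.deriv_of_isOpen isOpen_Ioo (by simp)

theorem contDiffOn_log_deriv_F :
    ContDiffOn ℝ (⊤ : ℕ∞) (fun x => Real.log (deriv X.F x)) (Set.Ioo X.b (X.a + 1)) :=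
  X.contDiffOn_deriv_F.log fun x hx => (X.deriv_pos x hx).ne'

theorem deriv_log_deriv_F_add_one (x : ℝ) : deriv (fun x => Real.log (deriv X.F x)) (x + 1) =
    deriv (fun x => Real.log (deriv X.F x)) x := by
  rw [← deriv_comp_add_const]
  simp only [X.deriv_F_add_one]

/-- A common scale for the estimates at both ends of the flat interval. -/
theorem end_estimates (hℓ : 1 < ℓ) : ∃ δ > 0, δ ≤ 1 / 3 ∧ δ ≤ (X.a + 1 - X.b) / 3 ∧ ∃ M ≥ 1,
    ∀ t ∈ Set.Ioo 0 δ,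
      (deriv X.F (X.a - t) ≤ M * t ^ (ℓ - 1) ∧ t ^ ℓ ≤ M * (X.F X.a - X.F (X.a - t)) ∧
      |deriv (fun x => Real.log (deriv X.F x)) (X.a - t)| ≤ M / t) ∧
      (deriv X.F (X.b + t) ≤ M * t ^ (ℓ - 1) ∧ t ^ ℓ ≤ M * (X.F (X.b + t) - X.F X.b) ∧
      |deriv (fun x => Real.log (deriv X.F x)) (X.b + t)| ≤ M / t) := by
  obtain ⟨-, δ₁, hδ₁, M₁, hM₁, h₁⟩ := X.left_estimates hℓ
  obtain ⟨-, δ₂, hδ₂, M₂, hM₂, h₂⟩ := X.right_estimates hℓ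
  have hba := X.hba
  have hab := X.hab
  refine ⟨min (min δ₁ δ₂) ((X.a + 1 - X.b) / 3), ?_, ?_, min_le_right _ _, 1 + M₁ + M₂, ?_, ?_⟩
  · exact lt_min (lt_min hδ₁ hδ₂) (by linarith)
  · exact (min_le_right _ _).trans (by linarith)
  · linarith
  · rintro t ⟨ht, ht'⟩
    have e₁ := h₁ t ⟨ht, ht'.trans_le ((min_le_left _ _).trans (min_le_left _ _))⟩
    have e₂ := h₂ t ⟨ht, ht'.trans_le ((min_le_left _ _).trans (min_le_right _ _))⟩
    have hp : 0 ≤ t ^ (ℓ - 1) := Real.rpow_nonneg ht.le _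
    have hq : 0 ≤ X.F X.a - X.F (X.a - t) := sub_nonneg.2 (X.mono (by linarith))
    have hr : 0 ≤ X.F (X.b + t) - X.F X.b := sub_nonneg.2 (X.mono (by linarith))
    refine ⟨⟨e₁.1.trans ?_, e₁.2.1.trans ?_, e₁.2.2.trans ?_⟩,
      e₂.1.trans ?_, e₂.2.1.trans ?_, e₂.2.2.trans ?_⟩ <;> gcongr <;> linarith

theorem deriv_F_nonneg (x : ℝ) : 0 ≤ deriv X.F x := X.mono.deriv_nonneg

theorem deriv_F_bounded (hℓ : 1 < ℓ) : ∃ G > 0, ∀ x, deriv X.F x ≤ G := by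
  obtain ⟨δ, hδ, hδ3, hδ', M, hM, h⟩ := X.end_estimates hℓ
  have hba := X.hba
  obtain ⟨G, hG, hGb⟩ := abs_bound_on_Icc X.contDiffOn_deriv_F.continuousOn
    (u := X.b + δ) (v := X.a + 1 - δ) (by linarith) (by linarith)
  have small : ∀ t ∈ Set.Ioo 0 δ, M * t ^ (ℓ - 1) ≤ M + G := by
    intro t ht
    have : t ^ (ℓ - 1) ≤ 1 := Real.rpow_le_one ht.1.le (by linarith [ht.2]) (by linarith)
    nlinarith
  refine ⟨M + G, by linarith, X.exists_translate _ (fun x k => ?_) (fun x hx => ?_)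
    (fun x hx => ?_)⟩
  · rw [X.deriv_F_add_int]; exact id
  · rw [(X.hasDerivAt_of_mem_Icc hℓ hx).deriv]; linarith
  · rcases lt_or_ge x (X.b + δ) with h1 | h1
    · have := h (x - X.b) ⟨by linarith [hx.1], by linarith⟩
      rw [add_sub_cancel] at this
      exact this.2.1.trans (small _ ⟨by linarith [hx.1], by linarith⟩)
    rcases lt_or_ge (X.a + 1 - δ) x with h2 | h2
    · have := h (X.a + 1 - x) ⟨by linarith [hx.2], by linarith⟩
      rw [show X.a - (X.a + 1 - x) = x - 1 by ring] at this
      have e := X.deriv_F_add_one (x - 1)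
      rw [sub_add_cancel] at e
      rw [e]
      exact this.1.1.trans (small _ ⟨by linarith [hx.2], by linarith⟩)
    · linarith [le_abs_self (deriv X.F x), hGb x ⟨h1, h2⟩]

theorem deriv_F_le_rpow (hℓ : 1 < ℓ) : ∃ K > 0, ∀ s, 0 < s →
    deriv X.F (X.a - s) ≤ K * s ^ (ℓ - 1) ∧ deriv X.F (X.b + s) ≤ K * s ^ (ℓ - 1) := by
  obtain ⟨δ, hδ, -, -, M, hM, h⟩ := X.end_estimates hℓ
  obtain ⟨G, hG, hGb⟩ := X.deriv_F_bounded hℓ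
  have hδp : 0 < δ ^ (ℓ - 1) := Real.rpow_pos_of_pos hδ _
  refine ⟨M + G / δ ^ (ℓ - 1), by positivity, fun s hs => ?_⟩
  have hsp : 0 < s ^ (ℓ - 1) := Real.rpow_pos_of_pos hs _
  rcases lt_or_ge s δ with h1 | h1
  · have e := h s ⟨hs, h1⟩
    have : M * s ^ (ℓ - 1) ≤ (M + G / δ ^ (ℓ - 1)) * s ^ (ℓ - 1) := by
      gcongr
      exact le_add_of_nonneg_right (by positivity)
    exact ⟨e.1.1.trans this, e.2.1.trans this⟩
  · have h2 : δ ^ (ℓ - 1) ≤ s ^ (ℓ - 1) := Real.rpow_le_rpow hδ.le h1 (by linarith)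
    have : G ≤ (M + G / δ ^ (ℓ - 1)) * s ^ (ℓ - 1) := by
      calc G = G / δ ^ (ℓ - 1) * δ ^ (ℓ - 1) := by field_simp
        _ ≤ (M + G / δ ^ (ℓ - 1)) * s ^ (ℓ - 1) := by
          gcongr
          linarith
    exact ⟨(hGb _).trans this, (hGb _).trans this⟩

theorem rpow_le_F_sub (hℓ : 1 < ℓ) : ∃ K > 0, ∀ s, 0 < s → s ≤ 1 →
    s ^ ℓ ≤ K * (X.F X.a - X.F (X.a - s)) ∧ s ^ ℓ ≤ K * (X.F (X.b + s) - X.F X.b) := by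
  obtain ⟨δ, hδ, -, -, M, hM, h⟩ := X.end_estimates hℓ
  have hδp : 0 < (δ / 2) ^ ℓ := Real.rpow_pos_of_pos (by linarith) _
  refine ⟨M + M / (δ / 2) ^ ℓ, by positivity, fun s hs hs1 => ?_⟩
  have ha : 0 ≤ X.F X.a - X.F (X.a - s) := sub_nonneg.2 (X.mono (by linarith))
  have hb : 0 ≤ X.F (X.b + s) - X.F X.b := sub_nonneg.2 (X.mono (by linarith))
  have hK : M ≤ M + M / (δ / 2) ^ ℓ := le_add_of_nonneg_right (by positivity)
  rcases lt_or_ge s δ with h1 | h1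
  · have e := h s ⟨hs, h1⟩
    exact ⟨e.1.2.1.trans (by gcongr), e.2.2.1.trans (by gcongr)⟩
  · have e := h (δ / 2) ⟨by linarith, by linarith⟩
    have hs1' : s ^ ℓ ≤ 1 := Real.rpow_le_one hs.le hs1 (by linarith)
    have h2 : X.F (X.a - s) ≤ X.F (X.a - δ / 2) := X.mono (by linarith)
    have h3 : X.F (X.b + δ / 2) ≤ X.F (X.b + s) := X.mono (by linarith)
    have key : ∀ y z : ℝ, 0 ≤ z → (δ / 2) ^ ℓ ≤ M * y → y ≤ z →
        s ^ ℓ ≤ (M + M / (δ / 2) ^ ℓ) * z := by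
      intro y z hz hy hyz
      calc s ^ ℓ ≤ (δ / 2) ^ ℓ / (δ / 2) ^ ℓ := by rwa [div_self hδp.ne']
        _ ≤ M * z / (δ / 2) ^ ℓ := by
          gcongr
          exact hy.trans (by gcongr)
        _ = M / (δ / 2) ^ ℓ * z := by ring
        _ ≤ _ := by
          gcongr
          linarith
    exact ⟨key _ _ ha e.1.2.1 (by linarith), key _ _ hb e.2.2.1 (by linarith)⟩

theorem abs_deriv_log_deriv_F_le (hℓ : 1 < ℓ) : ∃ K > 0, ∀ x ∈ Set.Ioo X.b (X.a + 1),
    |deriv (fun x => Real.log (deriv X.F x)) x| ≤ K * (1 / (x - X.b) + 1 / (X.a + 1 - x)) := by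
  obtain ⟨δ, hδ, hδ3, hδ', M, hM, h⟩ := X.end_estimates hℓ
  have hba := X.hba
  have hab := X.hab
  obtain ⟨W, hW, hWb⟩ := abs_bound_on_Icc
    (X.contDiffOn_log_deriv_F.continuousOn_deriv_of_isOpen isOpen_Ioo (by simp))
    (u := X.b + δ) (v := X.a + 1 - δ) (by linarith) (by linarith)
  refine ⟨M + W, by linarith, fun x hx => ?_⟩
  have hx1 : 0 < x - X.b := by linarith [hx.1]
  have hx2 : 0 < X.a + 1 - x := by linarith [hx.2]
  have p1 : 0 < 1 / (x - X.b) := by positivity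
  have p2 : 0 < 1 / (X.a + 1 - x) := by positivity
  rcases lt_or_ge x (X.b + δ) with h1 | h1
  · have := (h (x - X.b) ⟨hx1, by linarith⟩).2.2.2
    rw [add_sub_cancel, div_eq_mul_one_div] at this
    nlinarith
  rcases lt_or_ge (X.a + 1 - δ) x with h2 | h2
  · have := (h (X.a + 1 - x) ⟨hx2, by linarith⟩).1.2.2
    rw [show X.a - (X.a + 1 - x) = x - 1 by ring, div_eq_mul_one_div] at this
    have e := X.deriv_log_deriv_F_add_one (x - 1)
    rw [sub_add_cancel] at e
    rw [e]
    nlinarith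
  · have h3 : 1 ≤ 1 / (x - X.b) := by
      rw [le_div_iff₀ hx1]
      linarith [hx.2]
    nlinarith [hWb x ⟨h1, h2⟩]

/-- A Cherry map of bounded type satisfies the quantitative hypotheses `FlatMapData`. -/
theorem exists_flatMapData (hℓ : 1 < ℓ) (hbt : BoundedType X.rho) :
    ∃ (H : ℝ → ℝ) (R K c : ℝ), FlatMapData X.F (deriv X.F) H X.a X.b R ℓ K c := by
  obtain ⟨m, hm⟩ := X.rho_lim
  obtain ⟨H, H1, H2, H3⟩ := exists_semiconj_translation X.mono X.degree_one (hm 0)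
  obtain ⟨c, hc, hbad⟩ := hbt.exists_badlyApproximable X.rho_mem X.rho_irrational
  obtain ⟨G, hG, hGb⟩ := X.deriv_F_bounded hℓ
  obtain ⟨K₁, hK₁, h₁⟩ := X.deriv_F_le_rpow hℓ
  obtain ⟨K₂, hK₂, h₂⟩ := X.rpow_le_F_sub hℓ
  obtain ⟨K₃, hK₃, h₃⟩ := X.abs_deriv_log_deriv_F_le hℓ
  have le₁ : K₁ ≤ 1 + G + K₁ + K₂ + K₃ := by linarith
  have le₂ : K₂ ≤ 1 + G + K₁ + K₂ + K₃ := by linarith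
  refine ⟨H, X.rho + m, 1 + G + K₁ + K₂ + K₃, c,
    { hab := X.hab
      hba := X.hba
      hℓ := hℓ
      hK := by linarith
      hc := hc
      mono := X.mono
      degree_one := X.degree_one
      flat := X.flat X.b ⟨X.hab.le, le_rfl⟩
      hasDerivAt := fun x => (X.differentiableAt_F hℓ x).hasDerivAt
      g_add_one := X.deriv_F_add_one
      g_nonneg := X.deriv_F_nonneg
      g_le := fun x => (hGb x).trans (by linarith)
      g_left := fun s hs => (h₁ s hs).1.trans (by gcongr)
      g_right := fun s hs => (h₁ s hs).2.trans (by gcongr)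
      F_left := fun s hs hs1 => (h₂ s hs hs1).1.trans
        (mul_le_mul_of_nonneg_right le₂ (sub_nonneg.2 (X.mono (by linarith))))
      F_right := fun s hs hs1 => (h₂ s hs hs1).2.trans
        (mul_le_mul_of_nonneg_right le₂ (sub_nonneg.2 (X.mono (by linarith))))
      g_pos := X.deriv_pos
      log_g_variation := fun u v hu huv hv => ?_
      no_periodic := fun n hn k x => X.iterate_F_ne hn k x
      H_mono := H1
      H_add_one := H2
      H_semiconj := H3
      badly := fun t ht k => ?_ }⟩
  · refine abs_sub_le_of_abs_deriv_le (fun x hx => ?_) (fun x hx => (h₃ x hx).trans ?_)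
      u v hu huv hv
    · exact (X.contDiffOn_log_deriv_F.differentiableOn (by simp)).differentiableAt
        (isOpen_Ioo.mem_nhds hx)
    · have p1 : 0 < x - X.b := by linarith [hx.1]
      have p2 : 0 < X.a + 1 - x := by linarith [hx.2]
      gcongr
      linarith
  · have := hbad t ht (t * m + k)
    push_cast at this
    rwa [show (t : ℝ) * (X.rho + m) + k = t * X.rho + (t * m + k) by ring]

theorem norm_iterate_c_sub (n : ℕ) : ∃ k : ℤ, ‖X.f^[n] X.c - X.c‖ =
    |X.F^[n] (X.F X.a) + k - X.F X.a| := by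
  refine ⟨-round ((1 : ℝ)⁻¹ * (X.F^[n] (X.F X.a) - X.F X.a)), ?_⟩
  rw [c, X.isLift, X.iterate_coe, ← AddCircle.coe_sub, AddCircle.norm_eq]
  congr 1
  push_cast
  ring

theorem neg_log_norm_nonneg (x : AddCircle (1 : ℝ)) : 0 ≤ -Real.log ‖x‖ := by
  have : ‖x‖ ≤ |(1 : ℝ)| / 2 := AddCircle.norm_le_half_period 1 one_ne_zero
  rw [abs_one] at this
  exact neg_nonneg.2 (Real.log_nonpos (norm_nonneg _) (by linarith))

end CherryMap

theorem cfQ_pos {ρ : ℝ} (hA : ∀ n, 1 ≤ cfA ρ (n + 1)) : ∀ n, 1 ≤ cfQ ρ n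
  | 0 => le_rfl
  | 1 => hA 0
  | n + 2 => (cfQ_pos hA n).trans (Nat.le_add_left _ _)

theorem cfQ_le_succ {ρ : ℝ} (hA : ∀ n, 1 ≤ cfA ρ (n + 1)) : ∀ n, cfQ ρ n ≤ cfQ ρ (n + 1)
  | 0 => hA 0
  | n + 1 => (Nat.le_mul_of_pos_left _ (hA (n + 1))).trans (Nat.le_add_right _ _)

theorem two_pow_le_cfQ_sq {ρ : ℝ} (hA : ∀ n, 1 ≤ cfA ρ (n + 1)) : ∀ n, 2 ^ n ≤ cfQ ρ (n + 1) ^ 2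
  | 0 => Nat.one_le_pow _ _ (cfQ_pos hA 1)
  | 1 => by
    have h1 : cfQ ρ 2 = cfA ρ 2 * cfQ ρ 1 + cfQ ρ 0 := rfl
    nlinarith [hA 0, hA 1, cfQ_pos hA 0, cfQ_pos hA 1, Nat.mul_le_mul (hA 1) (cfQ_pos hA 1)]
  | n + 2 => by
    have h1 : cfQ ρ (n + 3) = cfA ρ (n + 3) * cfQ ρ (n + 2) + cfQ ρ (n + 1) := rfl
    have h2 : 2 * cfQ ρ (n + 1) ≤ cfQ ρ (n + 3) := by
      have : cfQ ρ (n + 2) ≤ cfA ρ (n + 3) * cfQ ρ (n + 2) := Nat.le_mul_of_pos_left _ (hA (n + 2))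
      have : cfQ ρ (n + 1) ≤ cfQ ρ (n + 2) := cfQ_le_succ hA (n + 1)
      omega
    have := two_pow_le_cfQ_sq hA n
    calc 2 ^ (n + 2) = 4 * 2 ^ n := by ring
      _ ≤ 4 * cfQ ρ (n + 1) ^ 2 := by gcongr
      _ = (2 * cfQ ρ (n + 1)) ^ 2 := by ring
      _ ≤ cfQ ρ (n + 2 + 1) ^ 2 := by gcongr

/-- The ratio of a sublinear power of `q_{l+2}` to `q_{l+1}` decays geometrically for a number
of bounded type. -/
theorem BoundedType.exists_rpow_cfQ_div_le {ρ : ℝ} (hA : ∀ n, 1 ≤ cfA ρ (n + 1))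
    (hbt : BoundedType ρ) {s : ℝ} (hs : s ∈ Set.Ioo (0 : ℝ) 1) :
    ∃ K > 0, ∃ C ∈ Set.Ioo (0 : ℝ) 1, ∀ l : ℕ,
      (cfQ ρ (l + 2) : ℝ) ^ s / (cfQ ρ (l + 1) : ℝ) ≤ K * C ^ l := by
  obtain ⟨M, hM⟩ := hbt
  refine ⟨((M : ℝ) + 1) ^ s, by positivity, (2 : ℝ) ^ (-((1 - s) / 2)), ⟨by positivity, ?_⟩,
    fun l => ?_⟩
  · exact Real.rpow_lt_one_of_one_lt_of_neg one_lt_two (by linarith [hs.2])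
  · have hq : (0 : ℝ) < cfQ ρ (l + 1) := by exact_mod_cast cfQ_pos hA (l + 1)
    have h1 : (cfQ ρ (l + 2) : ℝ) ≤ (M + 1) * cfQ ρ (l + 1) := by
      have e : cfQ ρ (l + 2) = cfA ρ (l + 2) * cfQ ρ (l + 1) + cfQ ρ l := rfl
      have := Nat.mul_le_mul_right (cfQ ρ (l + 1)) (hM (l + 2) (by omega))
      have := cfQ_le_succ hA l
      exact_mod_cast (by rw [e, add_one_mul]; omega :
        cfQ ρ (l + 2) ≤ (M + 1) * cfQ ρ (l + 1))
    have h2 : (2 : ℝ) ^ (l : ℝ) ≤ (cfQ ρ (l + 1) : ℝ) ^ (2 : ℝ) := by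
      rw [Real.rpow_natCast, Real.rpow_two]
      exact_mod_cast two_pow_le_cfQ_sq hA l
    have h3 : (2 : ℝ) ^ ((l : ℝ) * ((1 - s) / 2)) ≤ (cfQ ρ (l + 1) : ℝ) ^ (1 - s) := by
      have := Real.rpow_le_rpow (by positivity) h2
        (show 0 ≤ (1 - s) / 2 by linarith [hs.2])
      rwa [← Real.rpow_mul (by norm_num), ← Real.rpow_mul hq.le,
        show (2 : ℝ) * ((1 - s) / 2) = 1 - s by ring] at this
    have h4 : ((2 : ℝ) ^ (-((1 - s) / 2))) ^ l = ((2 : ℝ) ^ ((l : ℝ) * ((1 - s) / 2)))⁻¹ := by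
      rw [← Real.rpow_natCast, ← Real.rpow_mul (by norm_num), ← Real.rpow_neg (by norm_num)]
      congr 1; ring
    calc (cfQ ρ (l + 2) : ℝ) ^ s / (cfQ ρ (l + 1) : ℝ)
        ≤ ((M + 1) * cfQ ρ (l + 1)) ^ s / (cfQ ρ (l + 1) : ℝ) := by
          gcongr
          exact hs.1.le
      _ = (M + 1 : ℝ) ^ s * ((cfQ ρ (l + 1) : ℝ) ^ (1 - s))⁻¹ := by
          rw [Real.mul_rpow (by positivity) hq.le, Real.rpow_sub hq, Real.rpow_one]
          field_simp
      _ ≤ (M + 1 : ℝ) ^ s * ((2 : ℝ) ^ (-((1 - s) / 2))) ^ l := by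
          rw [h4]
          gcongr

/-- for a Cherry map of exponent `ℓ ∈ (1,2]` with rotation number of bounded
type, the series `Σ_l (−log |f^{q_{l+2}}(c) − c|)/q_{l+1}` is summable and there are
`K' > 0`, `C ∈ (0,1)` with `Σ_{l=n₀}^∞ (−log |f^{q_{l+2}}(c) − c|)/q_{l+1} ≤ K'·C^{n₀}`
for all large `n₀`; in particular the tails tend to `0`. -/
theorem tail_sum_neg_log_close_return (ℓ : ℝ) (hℓ : ℓ ∈ Set.Ioc (1 : ℝ) 2)
    (X : CherryMap ℓ) (hbt : BoundedType X.rho) :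
    Summable (fun l : ℕ =>
      (-Real.log ‖X.f^[cfQ X.rho (l + 2)] X.c - X.c‖) / (cfQ X.rho (l + 1) : ℝ)) ∧
    (∃ K' > 0, ∃ C ∈ Set.Ioo (0 : ℝ) 1, ∀ᶠ n₀ in atTop,
      (∑' l : ℕ,
        (-Real.log ‖X.f^[cfQ X.rho (n₀ + l + 2)] X.c - X.c‖) / (cfQ X.rho (n₀ + l + 1) : ℝ))
        ≤ K' * C ^ n₀) ∧
    Tendsto (fun n₀ : ℕ => ∑' l : ℕ,
        (-Real.log ‖X.f^[cfQ X.rho (n₀ + l + 2)] X.c - X.c‖) / (cfQ X.rho (n₀ + l + 1) : ℝ))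
      atTop (nhds 0) := by
  have hA := one_le_cfA X.rho_mem X.rho_irrational
  obtain ⟨H, R, K, c, hD⟩ := X.exists_flatMapData hℓ.1 hbt
  obtain ⟨Q, hQ, s, hs, hlog⟩ := hD.exists_neg_log_return_le
  obtain ⟨K₁, hK₁, C, hC, hgeom⟩ := hbt.exists_rpow_cfQ_div_le hA hs
  set T : ℕ → ℝ := fun l =>
    (-Real.log ‖X.f^[cfQ X.rho (l + 2)] X.c - X.c‖) / (cfQ X.rho (l + 1) : ℝ) with hT
  have hT0 : ∀ l, 0 ≤ T l := fun l =>
    div_nonneg (CherryMap.neg_log_norm_nonneg _) (Nat.cast_nonneg _)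
  have hTle : ∀ l, T l ≤ Q * K₁ * C ^ l := by
    intro l
    obtain ⟨k, hk⟩ := X.norm_iterate_c_sub (cfQ X.rho (l + 2))
    have h1 := hlog _ (cfQ_pos hA (l + 2)) k
    calc T l ≤ Q * (cfQ X.rho (l + 2) : ℝ) ^ s / (cfQ X.rho (l + 1) : ℝ) := by
          simp only [hT, hk]
          gcongr
      _ = Q * ((cfQ X.rho (l + 2) : ℝ) ^ s / (cfQ X.rho (l + 1) : ℝ)) := mul_div_assoc _ _ _
      _ ≤ Q * (K₁ * C ^ l) := by gcongr; exact hgeom l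
      _ = Q * K₁ * C ^ l := by ring
  have hsum : Summable T := Summable.of_nonneg_of_le hT0 hTle
    ((summable_geometric_of_lt_one hC.1.le hC.2).mul_left _)
  have hC1 : 0 < 1 - C := sub_pos.2 hC.2
  have htail : ∀ n₀, ∑' l, T (n₀ + l) ≤ Q * K₁ / (1 - C) * C ^ n₀ := by
    intro n₀
    have hg := (hasSum_geometric_of_lt_one hC.1.le hC.2).mul_left (Q * K₁ * C ^ n₀)
    have hle : ∀ l, T (n₀ + l) ≤ Q * K₁ * C ^ n₀ * C ^ l := fun l => by
      rw [mul_assoc, ← pow_add]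
      exact hTle _
    calc ∑' l, T (n₀ + l) ≤ Q * K₁ * C ^ n₀ * (1 - C)⁻¹ := by
          rw [← hg.tsum_eq]
          exact (Summable.of_nonneg_of_le (fun l => hT0 _) hle hg.summable).tsum_le_tsum hle
            hg.summable
      _ = Q * K₁ / (1 - C) * C ^ n₀ := by ring
  refine ⟨hsum, ⟨Q * K₁ / (1 - C), by positivity, C, hC, Eventually.of_forall htail⟩, ?_⟩
  refine squeeze_zero (fun n₀ => tsum_nonneg fun l => hT0 (n₀ + l)) htail ?_
  simpa using (tendsto_pow_atTop_nhds_zero_of_lt_one hC.1.le hC.2).const_mul (Q * K₁ / (1 - C))
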